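/- There exists a constant C > 0 with the following property. Let t ≥ 1, A > 0, and let f : ℤ → ℂ be a sequence such that its Fourier transform f̂(ξ) = (2π)^{-1/2} ∑_{n∈ℤ} f_n e^{inξ} satisfies |f̂(ξ)| ≤ A for all ξ, and such that (∑_{n∈ℤ} n²|f_n|²)^{1/2} ≤ A·t^{1/6}. Define u_n(t) = (2π)^{-1/2} ∫_{−π}^{π} e^{2it cos ξ} f̂(ξ) e^{−inξ} dξ and let q(ξ) = (2π)^{-1/2} ∑_{n∈ℤ} |u_n(t)|² e^{inξ} be the Fourier transform of the sequence |u(t)|². Then for all n ∈ ℤ: |(2π)^{-1/2} ∫_{−π}^{π} sin(ξ/2) · q(ξ) · e^{−inξ} dξ| ≤ C · A² · t^{−1}. -/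

import Mathlib

/-- The Fourier transform of a sequence `f : ℤ → ℂ`:
`f̂(ξ) = (2π)^{-1/2} ∑_{n∈ℤ} f_n e^{inξ}`. -/
noncomputable def discFT (f : ℤ → ℂ) (ξ : ℝ) : ℂ :=
  (Real.sqrt (2 * Real.pi) : ℂ)⁻¹ *
    ∑' n : ℤ, f n * Complex.exp (Complex.I * (n : ℂ) * (ξ : ℂ))

/-- The linear Ablowitz–Ladik propagator applied to `f` at time `t`. -/
noncomputable def alProp (f : ℤ → ℂ) (t : ℝ) (n : ℤ) : ℂ :=
  (Real.sqrt (2 * Real.pi) : ℂ)⁻¹ *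
    ∫ ξ in (-Real.pi)..Real.pi,
      Complex.exp (((2 * t * Real.cos ξ : ℝ) : ℂ) * Complex.I) * discFT f ξ *
        Complex.exp (-(Complex.I * (n : ℂ) * (ξ : ℂ)))


namespace ALD

lemma sum_inv_sq_le (c l : ℝ) (hl : 1/2 ≤ l) (s : Finset ℤ) :
    ∑ m ∈ s, 1 / (((m:ℝ) - c)^2 + l^2) ≤ 9 * Real.pi / l := by
  have hl0 : 0 < l := by linarith
  have key : ∀ m : ℤ, 1 / (((m:ℝ) - c)^2 + l^2) ≤
      (9 / l) * (Real.arctan (((m:ℝ) + 1 - c)/l) - Real.arctan (((m:ℝ) - c)/l)) := by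
    intro m
    set z : ℝ := (m:ℝ) - c with hz
    have hd : ∀ y ∈ Set.Ioo z (z+1), HasDerivAt (fun y => Real.arctan (y / l))
        (1 / (1 + (y/l)^2) * (1/l)) y := by
      intro y _
      exact ((hasDerivAt_id y).div_const l).arctan
    obtain ⟨y, hy, hy2⟩ := exists_hasDerivAt_eq_slope (fun y => Real.arctan (y / l)) _
      (show z < z+1 by linarith) (by fun_prop) hd
    have h1 : Real.arctan (((m:ℝ) + 1 - c)/l) - Real.arctan (z/l) = 1 / (1 + (y/l)^2) * (1/l) := by
      rw [hy2]
      have : (m:ℝ) + 1 - c = z + 1 := by rw [hz]; ring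
      rw [this]; field_simp; ring
    rw [h1]
    have h2 : 9 / l * (1 / (1 + (y/l)^2) * (1/l)) = 9 / (l^2 + y^2) := by
      field_simp
    rw [h2, div_le_div_iff₀ (by positivity) (by positivity)]
    obtain ⟨ha, hb⟩ := hy
    nlinarith [sq_nonneg (z + (y - z)), sq_nonneg (z - (y-z)), mul_nonneg (sub_nonneg.2 ha.le) (sub_nonneg.2 hb.le)]
  obtain ⟨N, hN⟩ : ∃ N : ℕ, ∀ m ∈ s, -(N:ℤ) ≤ m ∧ m < N := by
    refine ⟨∑ m ∈ s, (m.natAbs + 1), fun m hm => ?_⟩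
    have := Finset.single_le_sum (f := fun m : ℤ => m.natAbs + 1) (fun _ _ => Nat.zero_le _) hm
    omega
  have hpos : ∀ m : ℤ, 0 ≤ 1 / (((m:ℝ) - c)^2 + l^2) := fun m => by positivity
  have hsub : s ⊆ (Finset.range (2*N)).image (fun j : ℕ => (j:ℤ) - N) := by
    intro m hm
    have := hN m hm
    simp only [Finset.mem_image, Finset.mem_range]
    exact ⟨(m + N).toNat, by omega, by omega⟩
  calc _ ≤ ∑ m ∈ (Finset.range (2*N)).image (fun j : ℕ => (j:ℤ) - N), 1 / (((m:ℝ) - c)^2 + l^2) :=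
        Finset.sum_le_sum_of_subset_of_nonneg hsub (fun _ _ _ => hpos _)
    _ = ∑ j ∈ Finset.range (2*N), 1 / (((((j:ℤ) - N : ℤ):ℝ) - c)^2 + l^2) := by
        rw [Finset.sum_image]; intro i _ j _ h; simpa using h
    _ ≤ ∑ j ∈ Finset.range (2*N), (9 / l) * ((fun j : ℕ => Real.arctan (((((j:ℤ) - N : ℤ):ℝ) - c)/l)) (j+1)
          - (fun j : ℕ => Real.arctan (((((j:ℤ) - N : ℤ):ℝ) - c)/l)) j) := by
        refine Finset.sum_le_sum fun j _ => ?_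
        have k := key ((j:ℤ)-N)
        have e : ((((j+1:ℕ):ℤ)-N:ℤ):ℝ) = (((j:ℤ)-N:ℤ):ℝ)+1 := by push_cast; ring
        simp only [e]
        exact k
    _ ≤ (9/l) * Real.pi := by
        rw [← Finset.mul_sum, Finset.sum_range_sub (fun j : ℕ => Real.arctan (((((j:ℤ) - N : ℤ):ℝ) - c)/l))]
        gcongr
        have := Real.arctan_lt_pi_div_two (((((2*N:ℕ):ℤ) - N : ℤ):ℝ) / l - c / l)
        have h1 := Real.arctan_lt_pi_div_two ((((((2*N:ℕ):ℤ) - N : ℤ):ℝ) - c)/l)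
        have h2 := Real.neg_pi_div_two_lt_arctan ((((((0:ℕ):ℤ) - N : ℤ):ℝ) - c)/l)
        linarith
    _ = _ := by ring

noncomputable def th (a : ℝ) (n : ℤ) : ℝ := Real.sqrt ((a^4)⁻¹ + |2 - |(n:ℝ)|/a^6|)

structure Hyp (a B : ℝ) (v g : ℤ → ℂ) : Prop where
  ha : 1 ≤ a
  hB : 0 ≤ B
  hrec : ∀ n : ℤ, (n:ℂ) * v n = (a:ℂ)^6 * (v (n-1) + v (n+1)) + g n
  v2 : ∀ s : Finset ℤ, ∑ m ∈ s, ‖v m‖^2 ≤ B^2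
  g2 : ∀ s : Finset ℤ, ∑ m ∈ s, ‖g m‖^2 ≤ (B*a)^2
  pt : ∀ n, ‖v n‖^2 * (a^6 * th a n) ≤ B^2

lemma th_sq {a : ℝ} (ha : 1 ≤ a) (n : ℤ) : th a n ^ 2 = (a^4)⁻¹ + |2 - |(n:ℝ)|/a^6| :=
  Real.sq_sqrt (by positivity)

lemma th_pos {a : ℝ} (ha : 1 ≤ a) (n : ℤ) : 0 < th a n := by
  have : 0 < (a^4)⁻¹ := by positivity
  exact Real.sqrt_pos.2 (by positivity)

lemma th_ge {a : ℝ} (ha : 1 ≤ a) (n : ℤ) : (a^2)⁻¹ ≤ th a n := by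
  apply Real.le_sqrt_of_sq_le
  have : ((a^2)⁻¹)^2 = (a^4)⁻¹ := by field_simp
  rw [this]; linarith [abs_nonneg (2 - |(n:ℝ)|/a^6)]

lemma th_comp {a : ℝ} (ha : 1 ≤ a) (n m : ℤ) (h : |(n:ℝ) - m| ≤ 2 * a^2) :
    th a n ^2 ≤ 3 * th a m ^2 := by
  rw [th_sq ha, th_sq ha]
  have h1 : |2 - |(n:ℝ)|/a^6| ≤ |2 - |(m:ℝ)|/a^6| + |(n:ℝ) - m| / a^6 := by
    have e : 2 - |(n:ℝ)|/a^6 = (2 - |(m:ℝ)|/a^6) + (|(m:ℝ)| - |(n:ℝ)|)/a^6 := by ring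
    rw [e]
    refine (abs_add_le _ _).trans ?_
    gcongr
    rw [abs_div, abs_of_pos (show 0 < a^6 by positivity)]
    have : |(|(m:ℝ)| - |(n:ℝ)|)| ≤ |(n:ℝ) - m| := by
      rw [abs_sub_comm (n:ℝ)]
      exact abs_abs_sub_abs_le _ _
    gcongr
  have h2 : |(n:ℝ) - m| / a^6 ≤ 2 * (a^4)⁻¹ := by
    calc _ ≤ 2 * a^2 / a^6 := by gcongr
      _ = _ := by field_simp
  have := abs_nonneg (2 - |(m:ℝ)|/a^6)
  linarith

lemma th_comp' {a : ℝ} (ha : 1 ≤ a) (n m : ℤ) (h : |(n:ℝ) - m| ≤ 2 * a^2) :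
    th a n ≤ 2 * th a m := by
  have := th_comp ha n m h
  have h1 := th_pos ha n
  have h2 := th_pos ha m
  nlinarith

variable {a B : ℝ} {v g : ℤ → ℂ}

lemma Hyp.v_le (H : Hyp a B v g) (n m : ℤ) (h : |(n:ℝ) - m| ≤ 2 * a^2) :
    ‖v m‖ ≤ 2 * B / (a^3 * Real.sqrt (th a n)) := by
  have ha := H.ha
  have hp := H.pt m
  have h1 := th_comp' ha n m h
  have h2 := th_pos ha n
  have hs : 0 < Real.sqrt (th a n) := Real.sqrt_pos.2 h2
  have hs2 := Real.sq_sqrt h2.le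
  have hB := H.hB
  apply le_of_sq_le_sq _ (by positivity)
  rw [div_pow, le_div_iff₀ (by positivity), mul_pow, hs2]
  have : ‖v m‖^2 * a^6 * th a n ≤ ‖v m‖^2 * a^6 * (2 * th a m) := by gcongr
  nlinarith

lemma Hyp.g_sum (H : Hyp a B v g) (s : Finset ℤ) :
    (∑ m ∈ s, ‖g m‖)^2 ≤ s.card * (B*a)^2 := by
  refine (sq_sum_le_card_mul_sum_sq).trans ?_
  have := H.g2 s
  gcongr

lemma Hyp.e_eq (H : Hyp a B v g) (m : ℤ) :
    v (m+1) - v m - (v m - v (m-1)) = (((m:ℝ)/a^6 - 2 : ℝ):ℂ) * v m - g m / (a:ℂ)^6 := by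
  have ha : (a:ℂ) ≠ 0 := by
    have := H.ha
    exact_mod_cast (by positivity : a ≠ 0)
  have := H.hrec m
  push_cast
  field_simp
  linear_combination -this

lemma Hyp.d_bound (H : Hyp a B v g) (n : ℤ) (hn : 0 ≤ n) :
    ‖v n - v (n-1)‖ ≤ 20 * B * Real.sqrt (th a n) / a^3 := by
  have ha := H.ha
  have hB := H.hB
  have ht := th_pos ha n
  have htg := th_ge ha n
  set s := Real.sqrt (th a n) with hs
  have hs0 : 0 < s := Real.sqrt_pos.2 ht
  have hs2 : s^2 = th a n := Real.sq_sqrt ht.le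
  have ha2 : 1 ≤ a^2 := one_le_pow₀ ha
  have hsa : 1 ≤ a * s := by
    have : (a^2)⁻¹ * a^2 ≤ s^2 * a^2 := by rw [hs2]; gcongr
    rw [inv_mul_cancel₀ (by positivity)] at this
    nlinarith [mul_pos (show 0 < a by positivity) hs0]
  have hv : ∀ m : ℤ, |(n:ℝ) - m| ≤ 2 * a^2 → ‖v m‖ ≤ 2 * B / (a^3 * s) := H.v_le n
  rcases le_or_gt 1 s with h1 | h1
  · have e1 := hv n (by simp; positivity)
    have e2 := hv (n-1) (by push_cast; rw [sub_sub_cancel, abs_one]; linarith)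
    calc _ ≤ ‖v n‖ + ‖v (n-1)‖ := norm_sub_le _ _
      _ ≤ 2 * B / (a^3 * s) + 2 * B / (a^3 * s) := by gcongr
      _ = 4 * B / a^3 * (1 / s) := by field_simp; ring
      _ ≤ 4 * B / a^3 * s := by
          gcongr
          rw [div_le_iff₀ hs0]; nlinarith
      _ ≤ _ := by
          rw [div_mul_eq_mul_div]
          gcongr
          linarith
  -- small s
  set N := ⌈1 / s^2⌉₊ with hN
  have hNge : 1 / s^2 ≤ N := Nat.le_ceil _
  have hone : 1 ≤ 1 / s^2 := by rw [le_div_iff₀ (by positivity)]; nlinarith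
  have hNle : (N:ℝ) ≤ 2 / s^2 := by
    have := Nat.ceil_lt_add_one (show 0 ≤ 1 / s^2 by positivity)
    have e : 2 / s^2 = 1/s^2 + 1/s^2 := by ring
    rw [← hN] at this
    linarith
  have hN1 : (1:ℝ) ≤ N := hone.trans hNge
  have hNa : (N:ℝ) ≤ 2 * a^2 := by
    refine hNle.trans ?_
    rw [div_le_iff₀ (by positivity)]
    nlinarith
  let d : ℤ → ℂ := fun m => v m - v (m-1)
  let e : ℤ → ℂ := fun m => v (m+1) - v m - (v m - v (m-1))
  have hE : ∑ i ∈ Finset.range N, ‖e (n + i)‖ ≤ 12 * B * s / a^3 + 2 * B * s / a^3 := by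
    have hei : ∀ i ∈ Finset.range N, ‖e (n+i)‖ ≤ 6 * B * s^3 / a^3 + ‖g (n+i)‖ / a^6 := by
      intro i hi
      rw [Finset.mem_range] at hi
      have hi' : (i:ℝ) ≤ N := by exact_mod_cast hi.le
      have hd : |(n:ℝ) - ((n + i : ℤ):ℝ)| ≤ 2 * a^2 := by
        push_cast
        rw [sub_add_cancel_left, abs_neg, abs_of_nonneg (by positivity)]; linarith
      have hd' : |((n + i : ℤ):ℝ) - (n:ℝ)| ≤ 2 * a^2 := by rwa [abs_sub_comm]
      have hx : |((n + i : ℤ):ℝ)/a^6 - 2| ≤ 3 * s^4 := by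
        have c := th_comp ha _ _ hd'
        rw [th_sq ha (n+i), ← hs2] at c
        have : |((n + i : ℤ):ℝ)| = ((n + i : ℤ):ℝ) := abs_of_nonneg (by exact_mod_cast (by omega))
        rw [this, abs_sub_comm] at c
        have : 0 ≤ (a^4)⁻¹ := by positivity
        nlinarith
      show ‖v (n + i+1) - v (n+i) - (v (n+i) - v (n+i-1))‖ ≤ _
      rw [H.e_eq]
      refine (norm_sub_le _ _).trans ?_
      rw [norm_mul, norm_div, norm_pow, Complex.norm_real, Complex.norm_real, Real.norm_eq_abs,
        Real.norm_eq_abs, abs_of_pos (show 0 < a by positivity)]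
      gcongr
      calc _ ≤ (3 * s^4) * (2 * B / (a^3 * s)) := by
            gcongr
            exact hv _ hd
        _ = _ := by field_simp; ring
    have hg : ∑ i ∈ Finset.range N, ‖g (n + i)‖ ≤ 2 * B * a / s := by
      have := H.g_sum ((Finset.range N).image (fun i : ℕ => n + (i:ℤ)))
      rw [Finset.sum_image (by intro i _ j _ h; simpa using h),
        Finset.card_image_of_injective _ (by intro i j h; simpa using h), Finset.card_range] at this
      apply le_of_sq_le_sq _ (by positivity)
      refine this.trans ?_
      calc (N:ℝ) * (B*a)^2 ≤ 2 / s^2 * (B*a)^2 := by gcongr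
        _ ≤ 4 / s^2 * (B*a)^2 := by gcongr; norm_num
        _ = _ := by ring
    calc _ ≤ ∑ i ∈ Finset.range N, (6 * B * s^3 / a^3 + ‖g (n+i)‖ / a^6) := Finset.sum_le_sum hei
      _ = N * (6 * B * s^3 / a^3) + (∑ i ∈ Finset.range N, ‖g (n+i)‖) / a^6 := by
          rw [Finset.sum_add_distrib, Finset.sum_const, Finset.card_range, nsmul_eq_mul, Finset.sum_div]
      _ ≤ 2 / s^2 * (6 * B * s^3 / a^3) + (2 * B * a / s) / a^6 := by gcongr
      _ ≤ _ := by
          have e1 : 2 / s^2 * (6 * B * s^3 / a^3) = 12 * B * s / a^3 := by field_simp; ring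
          rw [e1]
          refine add_le_add le_rfl ?_
          rw [div_div, div_le_div_iff₀ (by positivity) (by positivity)]
          have : 1 ≤ (a*s)^2 := one_le_pow₀ hsa
          calc 2 * B * a * a^3 = 2 * B * a^4 * 1 := by ring
            _ ≤ 2 * B * a^4 * (a*s)^2 := by gcongr
            _ = _ := by ring
  set E := 12 * B * s / a^3 + 2 * B * s / a^3 with hEdef
  have hdj : ∀ j ≤ N, ‖d (n+j) - d n‖ ≤ ∑ i ∈ Finset.range j, ‖e (n + i)‖ := by
    intro j _
    induction j with
    | zero => simp
    | succ j ih =>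
      rw [Finset.sum_range_succ]
      have : d (n + (j+1:ℕ)) - d n = (d (n+j) - d n) + e (n+j) := by
        simp only [d, e]; push_cast
        rw [show n + ((j:ℤ)+1) - 1 = n + j by ring, show n + ((j:ℤ)+1) = n + j + 1 by ring]; ring
      rw [this]
      exact (norm_add_le _ _).trans (by gcongr; exact ih (by omega))
  have htel : ∀ j : ℕ, ∑ i ∈ Finset.range j, d (n+i) = v (n + j - 1) - v (n-1) := by
    intro j
    induction j with
    | zero => simp
    | succ j ih =>
      rw [Finset.sum_range_succ, ih]; simp only [d]; push_cast
      rw [show n + ((j:ℤ)+1) - 1 = n + j by ring]; ring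
  have hmain : (N:ℝ) * ‖d n‖ ≤ 4 * B / (a^3*s) + N * E := by
    have e0 : (N:ℂ) * d n = (v (n + N - 1) - v (n-1)) - ∑ i ∈ Finset.range N, (d (n+i) - d n) := by
      rw [Finset.sum_sub_distrib, htel]; simp
    have e1 : (N:ℝ) * ‖d n‖ = ‖(N:ℂ) * d n‖ := by simp
    rw [e1, e0]
    have f1 := hv (n+N-1) (by
      push_cast
      rw [show (n:ℝ) - (n + N - 1) = -((N:ℝ) - 1) by ring, abs_neg, abs_of_nonneg (by linarith)]; linarith)
    have f2 := hv (n-1) (by push_cast; rw [sub_sub_cancel, abs_one]; linarith)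
    have f3 : ‖∑ i ∈ Finset.range N, (d (n+i) - d n)‖ ≤ N * E := by
      refine (norm_sum_le _ _).trans ?_
      calc _ ≤ ∑ i ∈ Finset.range N, E := by
            refine Finset.sum_le_sum fun i hi => ?_
            rw [Finset.mem_range] at hi
            refine (hdj i hi.le).trans (le_trans ?_ hE)
            exact Finset.sum_le_sum_of_subset_of_nonneg (by simpa using hi.le) (fun _ _ _ => norm_nonneg _)
        _ = _ := by simp
    calc _ ≤ ‖v (n + N - 1)‖ + ‖v (n-1)‖ + ‖∑ i ∈ Finset.range N, (d (n+i) - d n)‖ :=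
          (norm_sub_le _ _).trans (by gcongr; exact norm_sub_le _ _)
      _ ≤ 2 * B / (a^3 * s) + 2 * B / (a^3 * s) + N * E := by gcongr
      _ = _ := by ring
  have hfin : (N:ℝ) * ‖d n‖ ≤ N * (4 * B * s / a^3 + E) := by
    refine hmain.trans ?_
    have : 4 * B / (a^3 * s) ≤ N * (4 * B * s / a^3) := by
      calc 4 * B / (a^3 * s) = 1/s^2 * (4 * B * s / a^3) := by field_simp
        _ ≤ _ := by gcongr
    linarith
  have := le_of_mul_le_mul_left hfin (by linarith)
  refine this.trans ?_
  rw [hEdef, ← add_div, ← add_div]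
  gcongr
  nlinarith [mul_nonneg hB hs0.le]

end ALD

namespace ALD
variable {a B : ℝ} {v g : ℤ → ℂ}

lemma Hyp.refl (H : Hyp a B v g) :
    Hyp a B (fun m => (-1:ℂ)^m * v (-m)) (fun m => -((-1:ℂ)^m * g (-m))) where
  ha := H.ha
  hB := H.hB
  hrec n := by
    have := H.hrec (-n)
    rw [show -(n-1) = -n+1 by ring, show -(n+1) = -n-1 by ring, zpow_sub₀ (by norm_num), zpow_add₀ (by norm_num)]
    push_cast at this
    simp only [zpow_one]
    linear_combination (-(-1:ℂ)^n) * this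
  v2 s := by
    have := H.v2 (s.image (fun m => -m))
    rw [Finset.sum_image (by intro i _ j _ h; simpa using h)] at this
    simpa using this
  g2 s := by
    have := H.g2 (s.image (fun m => -m))
    rw [Finset.sum_image (by intro i _ j _ h; simpa using h)] at this
    simpa using this
  pt n := by
    have := H.pt (-n)
    have e : th a (-n) = th a n := by simp [th]
    rw [e] at this
    simpa using this

noncomputable def w (v : ℤ → ℂ) (m : ℤ) : ℝ := ‖v m‖^2 - ‖v (m-1)‖^2
noncomputable def R (v : ℤ → ℂ) (m : ℤ) : ℝ := (v m * (starRingEnd ℂ) (v (m-1))).re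

lemma w_eq (v : ℤ → ℂ) (m : ℤ) :
    w v m = ((v m).re)^2 + ((v m).im)^2 - (((v (m-1)).re)^2 + ((v (m-1)).im)^2) := by
  rw [w, ← Complex.normSq_eq_norm_sq, ← Complex.normSq_eq_norm_sq, Complex.normSq_apply, Complex.normSq_apply]; ring

lemma R_eq (v : ℤ → ℂ) (m : ℤ) :
    R v m = (v m).re * (v (m-1)).re + (v m).im * (v (m-1)).im := by
  rw [R]; simp

lemma Hyp.w_nonneg (H : Hyp a B v g) (n : ℤ) (hn : 0 ≤ n) : |w v n| ≤ 80 * B^2 / a^6 := by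
  have ha := H.ha
  have hB := H.hB
  have ha2 : 1 ≤ a^2 := one_le_pow₀ ha
  have hd := H.d_bound n hn
  have e1 := H.v_le n n (by simp; positivity)
  have e2 := H.v_le n (n-1) (by push_cast; rw [sub_sub_cancel, abs_one]; linarith)
  have hs : 0 < Real.sqrt (th a n) := Real.sqrt_pos.2 (th_pos ha n)
  set s := Real.sqrt (th a n)
  have : |w v n| = |‖v n‖ - ‖v (n-1)‖| * (‖v n‖ + ‖v (n-1)‖) := by
    rw [w, sq_sub_sq, abs_mul, abs_of_nonneg (by positivity : 0 ≤ ‖v n‖ + ‖v (n-1)‖)]; ring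
  rw [this]
  calc _ ≤ (20 * B * s / a^3) * (2 * B / (a^3 * s) + 2 * B / (a^3 * s)) := by
        gcongr
        exact (abs_norm_sub_norm_le _ _).trans hd
    _ = _ := by field_simp; ring

lemma Hyp.R_nonneg (H : Hyp a B v g) (n : ℤ) (hn : 0 ≤ n) : |R v (n+1) - R v n| ≤ 120 * B^2 / a^6 := by
  have ha := H.ha
  have hB := H.hB
  have ha2 : 1 ≤ a^2 := one_le_pow₀ ha
  have hd := H.d_bound n hn
  have hd' := H.d_bound (n+1) (by omega)
  have e1 := H.v_le n n (by simp; positivity)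
  have hth := th_comp' ha (n+1) n (by push_cast; rw [add_sub_cancel_left, abs_one]; linarith)
  have hs : 0 < Real.sqrt (th a n) := Real.sqrt_pos.2 (th_pos ha n)
  have hs' : Real.sqrt (th a (n+1)) ≤ 2 * Real.sqrt (th a n) := by
    apply Real.sqrt_le_iff.2 ⟨by positivity, ?_⟩
    rw [mul_pow, Real.sq_sqrt (th_pos ha n).le]
    linarith [th_pos ha n]
  have hd2 : ‖v (n+1) - v n‖ ≤ 40 * B * Real.sqrt (th a n) / a^3 := by
    rw [add_sub_cancel_right] at hd'
    refine hd'.trans ?_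
    gcongr ?_ / _
    nlinarith
  set s := Real.sqrt (th a n)
  have : R v (n+1) - R v n = ((starRingEnd ℂ) (v n) * (v (n+1) - v n + (v n - v (n-1)))).re := by
    rw [R_eq, R_eq, add_sub_cancel_right]; simp; ring
  rw [this]
  refine (Complex.abs_re_le_norm _).trans ?_
  rw [norm_mul, RCLike.norm_conj]
  calc _ ≤ (2 * B / (a^3 * s)) * (40 * B * s / a^3 + 20 * B * s / a^3) := by
        gcongr
        exact (norm_add_le _ _).trans (by gcongr)
    _ = _ := by field_simp; ring

lemma Hyp.w_le (H : Hyp a B v g) (n : ℤ) : |w v n| ≤ 120 * B^2 / a^6 := by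
  have ha := H.ha
  have h0 : 80 * B^2 / a^6 ≤ 120 * B^2 / a^6 := by gcongr; norm_num
  rcases le_or_gt 0 n with h | h
  · exact (H.w_nonneg n h).trans h0
  · refine le_trans (le_of_eq ?_) ((H.refl.w_nonneg (-n+1) (by omega)).trans h0)
    rw [w, w, abs_sub_comm]; simp
    rw [show -1 + n = n - 1 by ring]

lemma Hyp.R_le (H : Hyp a B v g) (n : ℤ) : |R v (n+1) - R v n| ≤ 120 * B^2 / a^6 := by
  rcases le_or_gt 0 n with h | h
  · exact H.R_nonneg n h
  · refine le_trans (le_of_eq ?_) (H.refl.R_nonneg (-n) (by omega))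
    have key : ∀ k : ℤ, R (fun m => (-1:ℂ)^m * v (-m)) k = - R v (-k+1) := by
      intro k
      rw [R, R]
      have h1 : (starRingEnd ℂ) ((-1:ℂ)^(k-1)) = (-1:ℂ)^(k-1) := by rw [map_zpow₀]; simp
      have h2 : (-1:ℂ)^k * (-1:ℂ)^(k-1) = -1 := by
        rw [← zpow_add₀ (by norm_num), show k + (k-1) = 2 * k - 1 by ring, zpow_sub₀ (by norm_num), zpow_mul]; simp
      rw [map_mul, h1, show -k + 1 - 1 = -k by ring, show -(k-1) = -k+1 by ring]
      have : (-1:ℂ) ^ k * v (-k) * ((-1:ℂ) ^ (k - 1) * (starRingEnd ℂ) (v (-k + 1)))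
        = - (v (-k) * (starRingEnd ℂ) (v (-k + 1))) := by
        linear_combination (v (-k) * (starRingEnd ℂ) (v (-k + 1))) * h2
      rw [this]; simp; ring
    rw [key, key]
    rw [show -(-n+1)+1 = n by ring, show - -n + 1 = n+1 by ring]
    congr 1; ring

/-- real form of the recursion -/
lemma Hyp.rec_re (H : Hyp a B v g) (n : ℤ) :
    (v (n+1)).re + (v (n-1)).re = (n:ℝ)/a^6 * (v n).re - (g n).re / a^6 ∧
    (v (n+1)).im + (v (n-1)).im = (n:ℝ)/a^6 * (v n).im - (g n).im / a^6 := by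
  have ha : a ≠ 0 := by have := H.ha; positivity
  have h := H.hrec n
  have h6 : ((a:ℂ)^6) = ((a^6:ℝ):ℂ) := by push_cast; rfl
  have hn : (n:ℂ) = ((n:ℝ):ℂ) := by push_cast; rfl
  rw [h6, hn] at h
  have h1 := congrArg Complex.re h
  have h2 := congrArg Complex.im h
  simp only [Complex.re_ofReal_mul, Complex.im_ofReal_mul, Complex.add_re, Complex.add_im] at h1 h2
  constructor
  · field_simp; linarith
  · field_simp; linarith

noncomputable def sg (m : ℤ) : ℝ := (-1:ℝ)^m
lemma sg_abs (m : ℤ) : |sg m| = 1 := by simp [sg, abs_zpow]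
lemma sg_succ (m : ℤ) : sg (m+1) = - sg m := by
  simp [sg, zpow_add₀]
lemma sg_pred (m : ℤ) : sg (m-1) = - sg m := by
  have := sg_succ (m-1); rw [sub_add_cancel] at this; linarith

noncomputable def y (v : ℤ → ℂ) (m : ℤ) : ℝ := sg m * w v m
noncomputable def T (v : ℤ → ℂ) (m : ℤ) : ℝ := sg m * (R v (m+1) - R v m)

lemma Hyp.y_le (H : Hyp a B v g) (n : ℤ) : |y v n| ≤ 120 * B^2 / a^6 := by
  rw [y, abs_mul, sg_abs, one_mul]; exact H.w_le n
lemma Hyp.T_le (H : Hyp a B v g) (n : ℤ) : |T v n| ≤ 120 * B^2 / a^6 := by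
  rw [T, abs_mul, sg_abs, one_mul]; exact H.R_le n

lemma re_mul_le (z u : ℂ) : |z.re * u.re + z.im * u.im| ≤ ‖z‖ * ‖u‖ := by
  have : z.re * u.re + z.im * u.im = (z * (starRingEnd ℂ) u).re := by simp
  rw [this]
  refine (Complex.abs_re_le_norm _).trans ?_
  rw [norm_mul, RCLike.norm_conj]

lemma Hyp.y_diff (H : Hyp a B v g) (m : ℤ) :
    |y v (m+1) - y v m| ≤ |(m:ℝ)|/a^6 * (120 * B^2 / a^6) + (‖v (m+1)‖ + ‖v (m-1)‖) * ‖g m‖ / a^6 := by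
  have ha := H.ha
  obtain ⟨h1, h2⟩ := H.rec_re m
  have e : y v (m+1) - y v m = -((m:ℝ)/a^6) * T v m +
      sg m * (((v (m+1) - v (m-1)).re * (g m).re + (v (m+1) - v (m-1)).im * (g m).im) / a^6) := by
    rw [y, y, T, w_eq, w_eq, R_eq, R_eq, sg_succ, add_sub_cancel_right]
    simp only [Complex.sub_re, Complex.sub_im]
    linear_combination (-sg m * ((v (m+1)).re - (v (m-1)).re)) * h1 + (-sg m * ((v (m+1)).im - (v (m-1)).im)) * h2
  rw [e]
  refine (abs_add_le _ _).trans ?_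
  rw [abs_mul, abs_mul (sg m), sg_abs, one_mul, abs_neg, abs_div, abs_div, abs_of_pos (show 0 < a^6 by positivity)]
  gcongr
  · exact H.T_le m
  · exact (re_mul_le _ _).trans (by gcongr; exact norm_sub_le _ _)

lemma Hyp.xy (H : Hyp a B v g) (m : ℤ) :
    |(m:ℝ)/a^6 * y v m - (T v m - T v (m-1))| ≤
      (‖v (m-1)‖^2 + ‖v m‖ * ‖g m‖ + ‖v (m-1)‖ * ‖g (m-1)‖) / a^6 := by
  have ha := H.ha
  obtain ⟨h1, h2⟩ := H.rec_re m
  obtain ⟨h3, h4⟩ := H.rec_re (m-1)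
  rw [sub_add_cancel] at h3 h4
  push_cast at h3 h4
  have e : (m:ℝ)/a^6 * y v m - (T v m - T v (m-1)) =
      sg m * ((- ‖v (m-1)‖^2 + ((v m).re * (g m).re + (v m).im * (g m).im)
        - ((v (m-1)).re * (g (m-1)).re + (v (m-1)).im * (g (m-1)).im))/a^6) := by
    rw [y, T, T, w_eq, sg_pred, sub_add_cancel, ← Complex.normSq_eq_norm_sq, Complex.normSq_apply]
    simp only [R_eq, add_sub_cancel_right]
    linear_combination (-sg m * (v m).re) * h1 + (-sg m * (v m).im) * h2
      + (sg m * (v (m-1)).re) * h3 + (sg m * (v (m-1)).im) * h4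
  rw [e, abs_mul, sg_abs, one_mul, abs_div, abs_of_pos (show 0 < a^6 by positivity)]
  gcongr
  refine (abs_sub _ _).trans (add_le_add ((abs_add_le _ _).trans (add_le_add ?_ (re_mul_le _ _))) (re_mul_le _ _))
  rw [abs_neg, abs_of_nonneg (by positivity)]

end ALD

namespace ALD
variable {a B : ℝ} {v g : ℤ → ℂ}

noncomputable def rr (a : ℝ) (m : ℤ) : ℝ := Real.sqrt ((m:ℝ)^2 + a^6)
noncomputable def kap (n m : ℤ) : ℝ := (n:ℝ) - m + 1/2

lemma rr_sq (ha : 1 ≤ a) (m : ℤ) : rr a m ^2 = (m:ℝ)^2 + a^6 := Real.sq_sqrt (by positivity)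
lemma rr_pos (ha : 1 ≤ a) (m : ℤ) : 0 < rr a m := Real.sqrt_pos.2 (by positivity)
lemma rr_ge (ha : 1 ≤ a) (m : ℤ) : a^3 ≤ rr a m := Real.le_sqrt_of_sq_le (by nlinarith [sq_nonneg (m:ℝ)])
lemma rr_ge' (ha : 1 ≤ a) (m : ℤ) : |(m:ℝ)| ≤ rr a m :=
  Real.le_sqrt_of_sq_le (by rw [sq_abs]; have : 0 ≤ a^6 := by positivity
                            linarith)

lemma M_le (ha : 1 ≤ a) (n m : ℤ) : |(n:ℝ)| + a^3 ≤ 3 * (rr a m + |kap n m|) := by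
  have h1 := rr_ge ha m
  have h2 := rr_ge' ha m
  have h3 : 1 ≤ a^3 := one_le_pow₀ ha
  have : (n:ℝ) = m + kap n m - 1/2 := by rw [kap]; ring
  have h4 : |(n:ℝ)| ≤ |(m:ℝ)| + |kap n m| + 1/2 := by
    rw [this]
    refine (abs_sub _ _).trans ?_
    rw [abs_of_pos (show (0:ℝ) < 1/2 by norm_num)]
    gcongr
    exact abs_add_le _ _
  have := abs_nonneg (kap n m)
  linarith

lemma inv_mul_le (ha : 1 ≤ a) (n m : ℤ) (hk : 0 < |kap n m|) :
    1 / (rr a m * |kap n m|) ≤ 3 / (|(n:ℝ)| + a^3) * (1 / |kap n m| + 1 / rr a m) := by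
  have hr := rr_pos ha m
  have hM : 0 < |(n:ℝ)| + a^3 := by positivity
  have := M_le ha n m
  have e : 3 / (|(n:ℝ)| + a^3) * (1 / |kap n m| + 1 / rr a m)
    = (3 * (rr a m + |kap n m|)) / (|(n:ℝ)| + a^3) * (1 / (rr a m * |kap n m|)) := by field_simp
  rw [e]
  have h1 : 1 ≤ (3 * (rr a m + |kap n m|)) / (|(n:ℝ)| + a^3) := by rwa [le_div_iff₀ hM, one_mul]
  have h2 : 0 ≤ 1 / (rr a m * |kap n m|) := by positivity
  nlinarith


lemma S1 (ha : 1 ≤ a) (n : ℤ) (s : Finset ℤ) (hs : ∀ m ∈ s, 1/2 ≤ |kap n m| ∧ a^6/(8*(|(n:ℝ)| + a^3)) ≤ |kap n m|) : ∑ m ∈ s, 1 / rr a m ^ 2 ≤ 144 * Real.pi * (|(n:ℝ)| + a^3) / a^6 := by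
  have h3 : 1 ≤ a^3 := one_le_pow₀ ha
  have h := sum_inv_sq_le 0 (a^3) (by linarith) s
  have e : ∀ m : ℤ, rr a m ^ 2 = ((m:ℝ) - 0)^2 + (a^3)^2 := by
    intro m; rw [rr_sq ha]; ring
  simp only [e]
  refine h.trans ?_
  rw [div_le_div_iff₀ (by positivity) (by positivity)]
  have := Real.pi_pos
  have : 0 ≤ |(n:ℝ)| := abs_nonneg _
  calc 9 * Real.pi * a^6 = 9 * Real.pi * a^3 * a^3 := by ring
    _ ≤ 144 * Real.pi * (|(n:ℝ)| + a^3) * a^3 := by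
      gcongr
      · norm_num
      · linarith

lemma S2' (ha : 1 ≤ a) (n : ℤ) (s : Finset ℤ) (hs : ∀ m ∈ s, 1/2 ≤ |kap n m| ∧ a^6/(8*(|(n:ℝ)| + a^3)) ≤ |kap n m|) (l : ℝ) (hl : 1/2 ≤ l) (h : ∀ m ∈ s, l ≤ |kap n m|) :
    ∑ m ∈ s, 1 / kap n m ^ 2 ≤ 18 * Real.pi / l := by
  have h0 := sum_inv_sq_le (n+1/2) l hl s
  calc _ ≤ ∑ m ∈ s, 2 * (1 / (((m:ℝ) - (n + 1/2))^2 + l^2)) := by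
        refine Finset.sum_le_sum fun m hm => ?_
        have := h m hm
        have h1 : l^2 ≤ kap n m ^2 := by rw [← sq_abs (kap n m)]; gcongr
        have h2 : ((m:ℝ) - (n+1/2))^2 = kap n m ^2 := by rw [kap]; ring
        have h3 : 0 < l := by linarith
        have h4 : 0 < l^2 := by positivity
        rw [h2, mul_one_div, div_le_div_iff₀ (by linarith) (by positivity)]
        linarith
    _ ≤ 2 * (9 * Real.pi / l) := by rw [← Finset.mul_sum]; gcongr
    _ = _ := by ring

lemma S2 (ha : 1 ≤ a) (n : ℤ) (s : Finset ℤ) (hs : ∀ m ∈ s, 1/2 ≤ |kap n m| ∧ a^6/(8*(|(n:ℝ)| + a^3)) ≤ |kap n m|) : ∑ m ∈ s, 1 / kap n m ^ 2 ≤ 144 * Real.pi * (|(n:ℝ)| + a^3) / a^6 := by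
  have hM : 0 < |(n:ℝ)| + a^3 := by positivity
  rcases le_or_gt (1/2) (a^6/(8*(|(n:ℝ)| + a^3))) with h | h
  · refine (S2' ha n s hs _ h (fun m hm => (hs m hm).2)).trans (le_of_eq ?_)
    field_simp; norm_num
  · refine (S2' ha n s hs _ le_rfl (fun m hm => (hs m hm).1)).trans ?_
    rw [div_lt_iff₀ (by positivity)] at h
    rw [div_le_div_iff₀ (by norm_num) (by positivity)]
    have := Real.pi_pos
    nlinarith

lemma S2c (ha : 1 ≤ a) (n : ℤ) (s : Finset ℤ) (hs : ∀ m ∈ s, 1/2 ≤ |kap n m| ∧ a^6/(8*(|(n:ℝ)| + a^3)) ≤ |kap n m|) : ∑ m ∈ s, 1 / kap n m ^ 2 ≤ 36 * Real.pi := by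
  refine (S2' ha n s hs _ le_rfl (fun m hm => (hs m hm).1)).trans (le_of_eq ?_)
  ring

lemma S3 (ha : 1 ≤ a) (n : ℤ) (s : Finset ℤ) (hs : ∀ m ∈ s, 1/2 ≤ |kap n m| ∧ a^6/(8*(|(n:ℝ)| + a^3)) ≤ |kap n m|) : ∑ m ∈ s, 1 / (rr a m * |kap n m|) ≤ 144 * Real.pi * (|(n:ℝ)| + a^3) / a^6 := by
  have h1 := S1 ha n s hs
  have h2 := S2 ha n s hs
  set σ := 144 * Real.pi * (|(n:ℝ)| + a^3) / a^6
  calc _ ≤ ∑ m ∈ s, (1/2) * (1 / rr a m ^ 2 + 1 / kap n m ^2) := by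
        refine Finset.sum_le_sum fun m hm => ?_
        have hr := rr_pos ha m
        have hk : 0 < |kap n m| := by linarith [(hs m hm).1]
        rw [← sq_abs (kap n m)]
        have := sq_nonneg (1 / rr a m - 1 / |kap n m|)
        have e : 1 / (rr a m * |kap n m|) = 1 / rr a m * (1 / |kap n m|) := by field_simp
        rw [e, ← one_div_pow, ← one_div_pow]
        nlinarith
    _ = (1/2) * (∑ m ∈ s, 1 / rr a m ^ 2 + ∑ m ∈ s, 1 / kap n m ^2) := by
        rw [← Finset.mul_sum, Finset.sum_add_distrib]
    _ ≤ σ := by linarith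

lemma S4 (ha : 1 ≤ a) (n : ℤ) (s : Finset ℤ) (hs : ∀ m ∈ s, 1/2 ≤ |kap n m| ∧ a^6/(8*(|(n:ℝ)| + a^3)) ≤ |kap n m|) : ∑ m ∈ s, a^6 / (rr a m ^2 * |kap n m|) ≤ 864 * Real.pi := by
  have h1 := S1 ha n s hs
  have h3 := S3 ha n s hs
  have hM : 0 < |(n:ℝ)| + a^3 := by positivity
  calc _ ≤ ∑ m ∈ s, a^6 * (3 / (|(n:ℝ)| + a^3)) * (1 / (rr a m * |kap n m|) + 1 / rr a m ^2) := by
        refine Finset.sum_le_sum fun m hm => ?_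
        have hr := rr_pos ha m
        have hk : 0 < |kap n m| := by linarith [(hs m hm).1]
        have := inv_mul_le ha n m hk
        have e : a^6 / (rr a m ^2 * |kap n m|) = a^6 / rr a m * (1 / (rr a m * |kap n m|)) := by field_simp
        rw [e]
        calc _ ≤ a^6 / rr a m * (3 / (|(n:ℝ)| + a^3) * (1 / |kap n m| + 1 / rr a m)) := by gcongr
          _ = _ := by field_simp
    _ = a^6 * (3 / (|(n:ℝ)| + a^3)) * (∑ m ∈ s, 1 / (rr a m * |kap n m|) + ∑ m ∈ s, 1 / rr a m ^2) := by
        rw [← Finset.mul_sum, Finset.sum_add_distrib]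
    _ ≤ a^6 * (3 / (|(n:ℝ)| + a^3)) * (144 * Real.pi * (|(n:ℝ)| + a^3) / a^6 + 144 * Real.pi * (|(n:ℝ)| + a^3) / a^6) := by gcongr
    _ = _ := by field_simp; norm_num

lemma S5 (ha : 1 ≤ a) (n : ℤ) (s : Finset ℤ) (hs : ∀ m ∈ s, 1/2 ≤ |kap n m| ∧ a^6/(8*(|(n:ℝ)| + a^3)) ≤ |kap n m|) : ∑ m ∈ s, a^6 / (rr a m * kap n m ^2) ≤ 864 * Real.pi := by
  have h2 := S2 ha n s hs
  have h3 := S3 ha n s hs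
  have hM : 0 < |(n:ℝ)| + a^3 := by positivity
  calc _ ≤ ∑ m ∈ s, a^6 * (3 / (|(n:ℝ)| + a^3)) * (1 / (rr a m * |kap n m|) + 1 / kap n m ^2) := by
        refine Finset.sum_le_sum fun m hm => ?_
        have hr := rr_pos ha m
        have hk : 0 < |kap n m| := by linarith [(hs m hm).1]
        have := inv_mul_le ha n m hk
        rw [← sq_abs (kap n m)]
        have e : a^6 / (rr a m * |kap n m|^2) = a^6 / |kap n m| * (1 / (rr a m * |kap n m|)) := by field_simp
        rw [e]
        calc _ ≤ a^6 / |kap n m| * (3 / (|(n:ℝ)| + a^3) * (1 / |kap n m| + 1 / rr a m)) := by gcongr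
          _ = _ := by field_simp; ring
    _ = a^6 * (3 / (|(n:ℝ)| + a^3)) * (∑ m ∈ s, 1 / (rr a m * |kap n m|) + ∑ m ∈ s, 1 / kap n m ^2) := by
        rw [← Finset.mul_sum, Finset.sum_add_distrib]
    _ ≤ a^6 * (3 / (|(n:ℝ)| + a^3)) * (144 * Real.pi * (|(n:ℝ)| + a^3) / a^6 + 144 * Real.pi * (|(n:ℝ)| + a^3) / a^6) := by gcongr
    _ = _ := by field_simp; norm_num

lemma S6 (ha : 1 ≤ a) (n : ℤ) (s : Finset ℤ) (hs : ∀ m ∈ s, 1/2 ≤ |kap n m| ∧ a^6/(8*(|(n:ℝ)| + a^3)) ≤ |kap n m|) : ∑ m ∈ s, 1 / (rr a m ^2 * kap n m ^2) ≤ 5184 * Real.pi / a^9 := by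
  have h1 := S1 ha n s hs
  have h2 := S2 ha n s hs
  have hM : 0 < |(n:ℝ)| + a^3 := by positivity
  calc _ ≤ ∑ m ∈ s, 18 / (|(n:ℝ)| + a^3)^2 * (1 / kap n m ^2 + 1 / rr a m ^2) := by
        refine Finset.sum_le_sum fun m hm => ?_
        have hr := rr_pos ha m
        have hk : 0 < |kap n m| := by linarith [(hs m hm).1]
        have := inv_mul_le ha n m hk
        rw [← sq_abs (kap n m), ← mul_pow, ← one_div_pow]
        calc _ ≤ (3 / (|(n:ℝ)| + a^3) * (1 / |kap n m| + 1 / rr a m))^2 := by gcongr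
          _ = (3 / (|(n:ℝ)| + a^3))^2 * (1 / |kap n m| + 1 / rr a m)^2 := by ring
          _ ≤ (3 / (|(n:ℝ)| + a^3))^2 * (2 * ((1 / |kap n m|)^2 + (1 / rr a m)^2)) := by
              gcongr; exact add_sq_le
          _ = _ := by rw [one_div_pow, one_div_pow, div_pow]; ring
    _ = 18 / (|(n:ℝ)| + a^3)^2 * (∑ m ∈ s, 1 / kap n m ^2 + ∑ m ∈ s, 1 / rr a m ^2) := by
        rw [← Finset.mul_sum, Finset.sum_add_distrib]
    _ ≤ 18 / (|(n:ℝ)| + a^3)^2 * (144 * Real.pi * (|(n:ℝ)| + a^3) / a^6 + 144 * Real.pi * (|(n:ℝ)| + a^3) / a^6) := by gcongr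
    _ = 5184 * Real.pi / ((|(n:ℝ)| + a^3) * a^6) := by field_simp; norm_num
    _ ≤ 5184 * Real.pi / (a^3 * a^6) := by
        have := Real.pi_pos
        gcongr; linarith [abs_nonneg (n:ℝ)]
    _ = _ := by ring

lemma c_le (ha : 1 ≤ a) (n : ℤ) (s : Finset ℤ) (hs : ∀ m ∈ s, 1/2 ≤ |kap n m| ∧ a^6/(8*(|(n:ℝ)| + a^3)) ≤ |kap n m|) (m : ℤ) (hm : m ∈ s) : 1 / (rr a m * |kap n m|) ≤ 27 / a^6 := by
  have hM : 0 < |(n:ℝ)| + a^3 := by positivity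
  have hr := rr_pos ha m
  have hk : 0 < |kap n m| := by linarith [(hs m hm).1]
  refine (inv_mul_le ha n m hk).trans ?_
  have h1 : 1 / |kap n m| ≤ 8 * (|(n:ℝ)| + a^3) / a^6 := by
    have := (hs m hm).2
    rw [div_le_div_iff₀ hk (by positivity)]
    rw [div_le_iff₀ (by positivity)] at this
    linarith
  have h2 : 1 / rr a m ≤ (|(n:ℝ)| + a^3) / a^6 := by
    have := rr_ge ha m
    calc 1 / rr a m ≤ 1 / a^3 := by gcongr
      _ = a^3 / a^6 := by field_simp
      _ ≤ _ := by gcongr; linarith [abs_nonneg (n:ℝ)]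
  calc _ ≤ 3 / (|(n:ℝ)| + a^3) * (8 * (|(n:ℝ)| + a^3) / a^6 + (|(n:ℝ)| + a^3) / a^6) := by gcongr
    _ = _ := by field_simp; norm_num


lemma Hyp.v_small (H : Hyp a B v g) (m : ℤ) (h : |(m:ℝ)| ≤ a^6) : ‖v m‖^2 ≤ B^2 / a^6 := by
  have ha := H.ha
  have h1 : 1 ≤ th a m := by
    apply Real.le_sqrt_of_sq_le
    have : |(m:ℝ)| / a^6 ≤ 1 := by rw [div_le_one (by positivity)]; exact h
    have h2 := le_abs_self (2 - |(m:ℝ)|/a^6)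
    have : 0 ≤ (a^4)⁻¹ := by positivity
    linarith
  rw [le_div_iff₀ (by positivity)]
  refine le_trans ?_ (H.pt m)
  gcongr
  nlinarith [show 0 < a^6 by positivity]

lemma Hyp.v_all (H : Hyp a B v g) (m : ℤ) : ‖v m‖^2 ≤ B^2 / a^4 := by
  have ha := H.ha
  have h1 := th_ge ha m
  rw [le_div_iff₀ (by positivity)]
  refine le_trans ?_ (H.pt m)
  gcongr
  calc a^4 = a^6 * (a^2)⁻¹ := by field_simp
    _ ≤ _ := by gcongr

lemma Hyp.vq (H : Hyp a B v g) (m m' : ℤ) (hmm : m' = m ∨ m' = m - 1) :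
    ‖v m'‖^2 / rr a m ^2 ≤ 2 * B^2 * (1 / (a^6 * rr a m ^2) + 1 / a^16) := by
  have ha := H.ha
  have hr := rr_pos ha m
  have h6 : 1 ≤ a^6 := one_le_pow₀ ha
  rcases le_or_gt |(m':ℝ)| (a^6) with h | h
  · calc _ ≤ (B^2 / a^6) / rr a m ^2 := by gcongr; exact H.v_small m' h
      _ = B^2 * (1 / (a^6 * rr a m ^2)) := by field_simp
      _ ≤ _ := by
        have : 0 ≤ 1 / a^16 := by positivity
        have : 0 ≤ 1 / (a^6 * rr a m ^2) := by positivity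
        nlinarith [sq_nonneg B]
  · have h1 : a^6 - 1 ≤ |(m:ℝ)| := by
      have : |(m':ℝ)| ≤ |(m:ℝ)| + 1 := by
        rcases hmm with rfl | rfl
        · linarith
        · push_cast
          refine (abs_sub _ _).trans (by simp)
      linarith
    have h2 : a^12 / 2 ≤ rr a m ^2 := by
      rw [rr_sq ha, ← sq_abs (m:ℝ)]
      nlinarith [sq_nonneg (a^6 - 2), sq_nonneg (|(m:ℝ)| - (a^6 - 1))]
    calc _ ≤ (B^2 / a^4) / (a^12/2) := by gcongr; exact H.v_all m'
      _ = 2 * B^2 * (1 / a^16) := by field_simp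
      _ ≤ _ := by
        have : 0 ≤ 1 / (a^6 * rr a m ^2) := by positivity
        gcongr
        linarith

lemma Hyp.vg (H : Hyp a B v g) (n : ℤ) (s : Finset ℤ)
    (hs : ∀ m ∈ s, 1/2 ≤ |kap n m| ∧ a^6/(8*(|(n:ℝ)| + a^3)) ≤ |kap n m|) (j : ℤ) (hj : j = 0 ∨ j = 1) :
    ∑ m ∈ s, 1 / (rr a m * |kap n m|) * (‖v (m-j)‖ * ‖g (m-j)‖) ≤ 300 * B^2 / a^6 := by
  have ha := H.ha
  have hB := H.hB
  have hg : ∑ m ∈ s, ‖g (m-j)‖^2 ≤ (B*a)^2 := by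
    have := H.g2 (s.image (fun m => m - j))
    rwa [Finset.sum_image (by intro i _ k _ h; simpa using h)] at this
  have hv : ∑ m ∈ s, (1 / (rr a m * |kap n m|) * ‖v (m-j)‖)^2 ≤ 2 * B^2 * (5220 * Real.pi / a^15) := by
    have h6 := S6 ha n s hs
    have h2 := S2c ha n s hs
    calc _ ≤ ∑ m ∈ s, 2 * B^2 * (1 / a^6 * (1 / (rr a m ^2 * kap n m ^2)) + 1 / a^16 * (1 / kap n m ^2)) := by
          refine Finset.sum_le_sum fun m hm => ?_
          have hr := rr_pos ha m
          have hk : 0 < |kap n m| := by linarith [(hs m hm).1]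
          have := H.vq m (m-j) (by rcases hj with rfl | rfl <;> simp)
          calc _ = (‖v (m-j)‖^2 / rr a m ^2) * (1 / |kap n m|^2) := by field_simp
            _ ≤ (2 * B^2 * (1 / (a^6 * rr a m ^2) + 1 / a^16)) * (1 / |kap n m|^2) := by gcongr
            _ = _ := by rw [← sq_abs (kap n m)]; field_simp
      _ = 2 * B^2 * (1 / a^6 * ∑ m ∈ s, (1 / (rr a m ^2 * kap n m ^2)) + 1 / a^16 * ∑ m ∈ s, (1 / kap n m ^2)) := by
          rw [← Finset.mul_sum, Finset.sum_add_distrib, Finset.mul_sum, Finset.mul_sum]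
      _ ≤ 2 * B^2 * (1 / a^6 * (5184 * Real.pi / a^9) + 1 / a^15 * (36 * Real.pi)) := by
          gcongr
          norm_num
      _ = _ := by field_simp; norm_num
  have cs := Finset.sum_mul_sq_le_sq_mul_sq s (fun m => 1 / (rr a m * |kap n m|) * ‖v (m-j)‖) (fun m => ‖g (m-j)‖)
  simp only [mul_assoc] at cs ⊢
  simp only [mul_assoc] at hv
  apply le_of_sq_le_sq _ (by positivity)
  refine cs.trans ((mul_le_mul hv hg (by positivity) (by positivity)).trans ?_)
  have hpi := Real.pi_lt_d2
  have : 5220 * Real.pi ≤ 20000 := by linarith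
  calc _ ≤ 2 * (B^2 * (20000 / a^15)) * (B*a)^2 := by gcongr
    _ = 40000 * B^4 / a^13 := by field_simp; ring
    _ ≤ 40000 * B^4 / a^12 := by
        gcongr
        norm_num
    _ ≤ 90000 * B^4 / a^12 := by gcongr; norm_num
    _ = _ := by ring

end ALD

namespace ALD
variable {a B : ℝ} {v g : ℤ → ℂ}

lemma sum_Ico_succ (p q : ℤ) (h : p ≤ q) (f : ℤ → ℝ) :
    ∑ m ∈ Finset.Ico p (q+1), f m = ∑ m ∈ Finset.Ico p q, f m + f q := by
  have : Finset.Ico p (q+1) = insert q (Finset.Ico p q) := by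
    ext x; simp; omega
  rw [this, Finset.sum_insert (by simp)]; ring

lemma sum_parts (p q : ℤ) (h : p ≤ q) (c T : ℤ → ℝ) :
    ∑ m ∈ Finset.Ico p q, c m * (T m - T (m-1)) =
      c q * T (q-1) - c p * T (p-1) + ∑ m ∈ Finset.Ico p q, (c m - c (m+1)) * T m := by
  induction q, h using Int.le_induction with
  | base => simp
  | succ q hq ih =>
    rw [sum_Ico_succ p q hq, sum_Ico_succ p q hq, ih, add_sub_cancel_right]; ring

lemma abs_tel (p q : ℤ) (h : p ≤ q) (f : ℤ → ℝ) :
    |f p - f q| ≤ ∑ m ∈ Finset.Ico p q, |f (m+1) - f m| := by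
  induction q, h using Int.le_induction with
  | base => simp
  | succ q hq ih =>
    rw [sum_Ico_succ p q hq]
    calc _ = |(f p - f q) - (f (q+1) - f q)| := by congr 1; ring
      _ ≤ |f p - f q| + |f (q+1) - f q| := abs_sub _ _
      _ ≤ _ := by gcongr

noncomputable def cc (a : ℝ) (n m : ℤ) : ℝ := a^6 * m / rr a m ^2 / kap n m

lemma kap_succ (n m : ℤ) : kap n (m+1) = kap n m - 1 := by simp [kap]; ring

lemma cc_abs (ha : 1 ≤ a) (n m : ℤ) (hk : 1/2 ≤ |kap n m|) : |cc a n m| ≤ a^6 * (1 / (rr a m * |kap n m|)) := by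
  have hr := rr_pos ha m
  have hr2 := rr_ge' ha m
  have hk0 : 0 < |kap n m| := by linarith
  rw [cc, abs_div, abs_div, abs_mul, abs_of_pos (show 0 < a^6 by positivity), abs_of_pos (show 0 < rr a m ^2 by positivity)]
  calc _ ≤ a^6 * rr a m / rr a m^2 / |kap n m| := by gcongr
    _ = _ := by field_simp

lemma cc_diff (ha : 1 ≤ a) (n m : ℤ) (hk : 1/2 ≤ |kap n m|) (hk' : 1/2 ≤ |kap n (m+1)|) :
    |cc a n m - cc a n (m+1)| ≤ 3 * (a^6 / (rr a m * kap n m ^2)) + 6 * (a^6 / (rr a m ^2 * |kap n m|)) := by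
  have hr := rr_pos ha m
  have hr2 := rr_ge' ha m
  have hr' := rr_pos ha (m+1)
  have hk0 : 0 < |kap n m| := by linarith
  have hk0' : 0 < |kap n (m+1)| := by linarith
  have hne : kap n m ≠ 0 := abs_pos.1 hk0
  have hne' : kap n (m+1) ≠ 0 := abs_pos.1 hk0'
  have hcmp : |kap n m| ≤ 3 * |kap n (m+1)| := by
    have : |kap n m| ≤ |kap n (m+1)| + 1 := by
      have e : kap n m = kap n (m+1) + 1 := by rw [kap_succ]; ring
      rw [e]; exact (abs_add_le _ _).trans (by simp)
    linarith
  have e : cc a n m - cc a n (m+1) = a^6 * m / rr a m ^2 * (-1 / (kap n m * kap n (m+1)))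
      + (a^6 * m / rr a m ^2 - a^6 * (m+1:ℤ) / rr a (m+1)^2) * (1 / kap n (m+1)) := by
    rw [cc, cc]
    have : (-1:ℝ) = kap n (m+1) - kap n m := by rw [kap_succ]; ring
    rw [this]; field_simp; ring
  rw [e]
  refine (abs_add_le _ _).trans ?_
  have hinv : 1 / |kap n (m+1)| ≤ 3 / |kap n m| := by
    rw [div_le_div_iff₀ hk0' hk0]; linarith
  gcongr
  · rw [abs_mul, abs_div, abs_div, abs_mul, abs_mul, abs_neg, abs_one, abs_of_pos (show 0 < a^6 by positivity), abs_of_pos (show 0 < rr a m ^2 by positivity)]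
    calc _ ≤ a^6 * rr a m / rr a m ^2 * (1 / (|kap n m| * |kap n (m+1)|)) := by gcongr
      _ = a^6 / rr a m * (1 / |kap n m|) * (1 / |kap n (m+1)|) := by field_simp
      _ ≤ a^6 / rr a m * (1 / |kap n m|) * (3 / |kap n m|) := by gcongr
      _ = _ := by rw [← sq_abs (kap n m)]; field_simp
  · have e2 : a^6 * m / rr a m ^2 - a^6 * (m+1:ℤ) / rr a (m+1)^2
        = a^6 / rr a m ^2 * ((m * (m+1) - a^6) / rr a (m+1)^2) := by
      have h1 := rr_sq ha m
      have h2 := rr_sq ha (m+1)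
      have p1 : (m:ℝ)^2 + a^6 ≠ 0 := by positivity
      have p2 : ((m+1:ℤ):ℝ)^2 + a^6 ≠ 0 := by positivity
      rw [h1, h2]
      field_simp
      push_cast
      ring
    have h3 : |((m:ℝ) * (m+1) - a^6) / rr a (m+1)^2| ≤ 2 := by
      rw [abs_div, abs_of_pos (show 0 < rr a (m+1)^2 by positivity), div_le_iff₀ (by positivity), rr_sq ha, abs_le]
      have : 1 ≤ a^6 := one_le_pow₀ ha
      push_cast
      constructor <;> nlinarith [sq_nonneg ((m:ℝ)+1), sq_nonneg (m+2:ℝ), sq_nonneg (m:ℝ)]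
    rw [e2, abs_mul, abs_mul, abs_div 1, abs_one, abs_div (a^6), abs_of_pos (show 0 < a^6 by positivity), abs_of_pos (show 0 < rr a m ^2 by positivity)]
    calc _ ≤ a^6 / rr a m ^2 * 2 * (3 / |kap n m|) := by gcongr
      _ = _ := by field_simp; norm_num

lemma Hyp.far (H : Hyp a B v g) (n p q : ℤ) (hpq : p ≤ q)
    (hs : ∀ m ∈ Finset.Icc p q, 1/2 ≤ |kap n m| ∧ a^6/(8*(|(n:ℝ)| + a^3)) ≤ |kap n m|) :
    |∑ m ∈ Finset.Ico p q, y v m / kap n m| ≤ 4000000 * B^2 / a^6 := by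
  have ha := H.ha
  have hB := H.hB
  have hs' : ∀ m ∈ Finset.Ico p q, 1/2 ≤ |kap n m| ∧ a^6/(8*(|(n:ℝ)| + a^3)) ≤ |kap n m| :=
    fun m hm => hs m (Finset.Ico_subset_Icc_self hm)
  have e : ∀ m ∈ Finset.Ico p q, y v m / kap n m = a^6 / (rr a m ^2 * kap n m) * y v m
      + (cc a n m * (T v m - T v (m-1)) + cc a n m * ((m:ℝ)/a^6 * y v m - (T v m - T v (m-1)))) := by
    intro m hm
    have hk : kap n m ≠ 0 := abs_pos.1 (by linarith [(hs' m hm).1])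
    have hr := rr_pos ha m
    rw [← mul_add, add_sub_cancel, cc]
    have := rr_sq ha m
    have h0 : (m:ℝ)^2 + a^6 ≠ 0 := by positivity
    rw [this]
    field_simp
    ring
  rw [Finset.sum_congr rfl e, Finset.sum_add_distrib, Finset.sum_add_distrib, sum_parts p q hpq]
  have b1 : |∑ m ∈ Finset.Ico p q, a^6 / (rr a m ^2 * kap n m) * y v m| ≤ 864 * Real.pi * (120 * B^2 / a^6) := by
    refine (Finset.abs_sum_le_sum_abs _ _).trans ?_
    calc _ ≤ ∑ m ∈ Finset.Ico p q, a^6 / (rr a m ^2 * |kap n m|) * (120 * B^2 / a^6) := by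
          refine Finset.sum_le_sum fun m hm => ?_
          have hr := rr_pos ha m
          rw [abs_mul, abs_div, abs_mul, abs_of_pos (show 0 < a^6 by positivity), abs_of_pos (show 0 < rr a m ^2 by positivity)]
          gcongr
          exact H.y_le m
      _ ≤ _ := by
          rw [← Finset.sum_mul]
          gcongr
          exact S4 ha n _ hs'
  have b2 : ∀ m ∈ Finset.Icc p q, |cc a n m| ≤ 27 := by
    intro m hm
    refine (cc_abs ha n m (hs m hm).1).trans ?_
    calc _ ≤ a^6 * (27 / a^6) := mul_le_mul_of_nonneg_left (c_le ha n _ hs m hm) (by positivity)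
      _ = _ := by field_simp
  have b3 : |∑ m ∈ Finset.Ico p q, (cc a n m - cc a n (m+1)) * T v m| ≤ 7776 * Real.pi * (120 * B^2 / a^6) := by
    refine (Finset.abs_sum_le_sum_abs _ _).trans ?_
    calc _ ≤ ∑ m ∈ Finset.Ico p q, (3 * (a^6 / (rr a m * kap n m ^2)) + 6 * (a^6 / (rr a m ^2 * |kap n m|))) * (120 * B^2 / a^6) := by
          refine Finset.sum_le_sum fun m hm => ?_
          have hr := rr_pos ha m
          rw [abs_mul]
          gcongr
          · exact cc_diff ha n m (hs' m hm).1 (hs (m+1) (by simp at hm ⊢; omega)).1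
          · exact H.T_le m
      _ ≤ _ := by
          rw [← Finset.sum_mul, Finset.sum_add_distrib, ← Finset.mul_sum, ← Finset.mul_sum]
          gcongr
          have := S4 ha n _ hs'
          have := S5 ha n _ hs'
          linarith
  have b4 : |∑ m ∈ Finset.Ico p q, cc a n m * ((m:ℝ)/a^6 * y v m - (T v m - T v (m-1)))| ≤ 627 * B^2 / a^6 := by
    refine (Finset.abs_sum_le_sum_abs _ _).trans ?_
    calc _ ≤ ∑ m ∈ Finset.Ico p q, (27 / a^6 * ‖v (m-1)‖^2 + 1 / (rr a m * |kap n m|) * (‖v (m-0)‖ * ‖g (m-0)‖)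
            + 1 / (rr a m * |kap n m|) * (‖v (m-1)‖ * ‖g (m-1)‖)) := by
          refine Finset.sum_le_sum fun m hm => ?_
          have hr := rr_pos ha m
          rw [abs_mul, sub_zero]
          calc _ ≤ (a^6 * (1 / (rr a m * |kap n m|))) * ((‖v (m-1)‖^2 + ‖v m‖ * ‖g m‖ + ‖v (m-1)‖ * ‖g (m-1)‖) / a^6) := by
                gcongr
                · exact cc_abs ha n m (hs' m hm).1
                · exact H.xy m
            _ = 1 / (rr a m * |kap n m|) * ‖v (m-1)‖^2 + 1 / (rr a m * |kap n m|) * (‖v m‖ * ‖g m‖)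
                + 1 / (rr a m * |kap n m|) * (‖v (m-1)‖ * ‖g (m-1)‖) := by
                  rw [mul_comm (a^6), mul_assoc, mul_div_cancel₀ _ (by positivity)]; ring
            _ ≤ _ := by
                exact add_le_add (add_le_add (mul_le_mul_of_nonneg_right (c_le ha n _ hs' m hm) (by positivity)) le_rfl) le_rfl
      _ ≤ 27 / a^6 * B^2 + 300 * B^2 / a^6 + 300 * B^2 / a^6 := by
          rw [Finset.sum_add_distrib, Finset.sum_add_distrib, ← Finset.mul_sum]
          have := H.v2 ((Finset.Ico p q).image (fun m => m - 1))
          rw [Finset.sum_image (by intro i _ k _ h; simpa using h)] at this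
          have e0 := H.vg n _ hs' 0 (Or.inl rfl)
          have e1 := H.vg n _ hs' 1 (Or.inr rfl)
          gcongr
      _ = _ := by ring
  have b5 : |cc a n q * T v (q-1)| ≤ 27 * (120 * B^2 / a^6) := by
    rw [abs_mul]; gcongr
    · exact b2 q (by simp [hpq])
    · exact H.T_le _
  have b6 : |cc a n p * T v (p-1)| ≤ 27 * (120 * B^2 / a^6) := by
    rw [abs_mul]; gcongr
    · exact b2 p (by simp [hpq])
    · exact H.T_le _
  have hpi : Real.pi ≤ 3.15 := Real.pi_lt_d2.le
  have hX : 0 ≤ B^2/a^6 := by positivity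
  have f1 : 864 * Real.pi * (120 * B^2 / a^6) ≤ 864 * 3.15 * (120 * B^2 / a^6) := by gcongr
  have f3 : 7776 * Real.pi * (120 * B^2 / a^6) ≤ 7776 * 3.15 * (120 * B^2 / a^6) := by gcongr
  simp only [mul_div_assoc] at *
  refine (abs_add_le _ _).trans ?_
  refine (add_le_add_right (abs_add_le _ _) _).trans ?_
  refine (add_le_add_right (add_le_add_left ((abs_add_le _ _).trans (add_le_add_left (abs_sub _ _) _)) _) _).trans ?_
  linarith

lemma sum_inv_sqrt (L : ℕ) : ∑ k ∈ Finset.range L, 1 / Real.sqrt (2*k+1) ≤ 2 * Real.sqrt L := by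
  induction L with
  | zero => simp
  | succ L ih =>
    rw [Finset.sum_range_succ]
    refine (add_le_add_left ih _).trans ?_
    have h0 : 0 < Real.sqrt (2*L+1) := Real.sqrt_pos.2 (by positivity)
    have h1 : Real.sqrt L ≤ Real.sqrt (2*L+1) := Real.sqrt_le_sqrt (by linarith [show (0:ℝ) ≤ L by positivity])
    have h2 : Real.sqrt (L+1:ℕ) ≤ Real.sqrt (2*L+1) := Real.sqrt_le_sqrt (by push_cast; linarith [show (0:ℝ) ≤ L by positivity])
    have e1 := Real.sq_sqrt (show (0:ℝ) ≤ L by positivity)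
    have e2 := Real.sq_sqrt (show (0:ℝ) ≤ (L+1:ℕ) by positivity)
    have h3 : Real.sqrt L ≤ Real.sqrt (L+1:ℕ) := Real.sqrt_le_sqrt (by push_cast; linarith)
    have : 1 / Real.sqrt (2*L+1) ≤ 2 * (Real.sqrt (L+1:ℕ) - Real.sqrt L) := by
      rw [div_le_iff₀ h0]
      push_cast at e2 h2 h3 ⊢
      nlinarith
    linarith

lemma Hyp.near (H : Hyp a B v g) (n : ℤ) (L : ℕ) (hL : (L:ℝ) ≤ a^6 / (2 * (|(n:ℝ)| + a^3))) :
    |∑ k ∈ Finset.range L, (y v (n-k) - y v (n+k+1)) / ((k:ℝ) + 1/2)| ≤ 200 * B^2 / a^6 := by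
  have ha := H.ha
  have hB := H.hB
  rcases Nat.eq_zero_or_pos L with rfl | hL0
  · simp; positivity
  have hL1 : (1:ℝ) ≤ L := by exact_mod_cast hL0
  have hM : 0 < |(n:ℝ)| + a^3 := by positivity
  rw [le_div_iff₀ (by positivity)] at hL
  have hn := abs_nonneg (n:ℝ)
  have h3 : 1 ≤ a^3 := one_le_pow₀ ha
  have ha6 : a^6 = a^3 * a^3 := by ring
  have hLa : (L:ℝ) ≤ a^3 / 2 := by
    have : (L:ℝ) * (2 * a^3) ≤ a^3 * a^3 := by nlinarith
    nlinarith
  have hMa : |(n:ℝ)| + a^3 ≤ a^6 / 2 := by nlinarith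
  have h32 : 2 ≤ a^3 := by nlinarith
  have step : ∀ k ∈ Finset.range L, |(y v (n-k) - y v (n+k+1)) / ((k:ℝ) + 1/2)| ≤
      240 * (|(n:ℝ)| + a^3) * B^2 / a^12 + 4 * B^2 / a^8 * (1 / Real.sqrt (2*k+1)) := by
    intro k hk
    rw [Finset.mem_range] at hk
    have hk' : (k:ℝ) + 1 ≤ L := by exact_mod_cast hk
    set I := Finset.Ico (n-k) (n+k+1) with hI
    have hcard : (I.card:ℝ) = 2*k+1 := by
      have h2k : (n + k + 1 - (n - k)).toNat = 2*k+1 := by omega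
      rw [hI, Int.card_Ico, h2k]
      push_cast; ring
    have hj : ∀ j ∈ I, |(j:ℝ)| + 1 ≤ |(n:ℝ)| + a^3 := by
      intro j hj
      rw [hI, Finset.mem_Ico] at hj
      have c1 : ((n - k : ℤ):ℝ) ≤ j := by exact_mod_cast hj.1
      have c2 : (j:ℝ) ≤ ((n + k : ℤ):ℝ) := by exact_mod_cast (by omega)
      push_cast at c1 c2
      have c3 : |(j:ℝ)| ≤ |(n:ℝ)| + k := by
        rw [abs_le]; constructor
        · linarith [neg_abs_le (n:ℝ)]
        · linarith [le_abs_self (n:ℝ)]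
      linarith
    have hvb : ∀ j : ℤ, |(j:ℝ)| ≤ |(n:ℝ)| + a^3 → ‖v j‖ ≤ B / a^3 := by
      intro j hj
      have := H.v_small j (by linarith)
      apply le_of_sq_le_sq _ (by positivity)
      rw [div_pow]; refine this.trans (le_of_eq ?_); ring
    have hgs : ∑ j ∈ I, ‖g j‖ ≤ Real.sqrt (2*k+1) * (B*a) := by
      have := H.g_sum I
      rw [hcard] at this
      apply le_of_sq_le_sq _ (by positivity)
      rw [mul_pow, Real.sq_sqrt (by positivity)]; exact this
    have main : |y v (n-k) - y v (n+k+1)| ≤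
        (2*k+1) * ((|(n:ℝ)| + a^3) / a^6 * (120 * B^2 / a^6)) + 2 * B / a^3 / a^6 * (Real.sqrt (2*k+1) * (B*a)) := by
      refine (abs_tel (n-k) (n+k+1) (by omega) (y v)).trans ?_
      calc _ ≤ ∑ j ∈ I, ((|(n:ℝ)| + a^3) / a^6 * (120 * B^2 / a^6) + 2 * B / a^3 / a^6 * ‖g j‖) := by
            refine Finset.sum_le_sum fun j hj' => (H.y_diff j).trans ?_
            have c := hj j hj'
            have v1 := hvb (j+1) (by push_cast; exact (abs_add_le _ _).trans (by simpa using c))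
            have v2 := hvb (j-1) (by push_cast; exact (abs_sub _ _).trans (by simpa using c))
            have : (‖v (j+1)‖ + ‖v (j-1)‖) * ‖g j‖ / a^6 ≤ 2 * B / a^3 / a^6 * ‖g j‖ := by
              calc _ ≤ (B/a^3 + B/a^3) * ‖g j‖ / a^6 := by gcongr
                _ = _ := by ring
            refine add_le_add ?_ this
            gcongr
            linarith
        _ = (2*k+1) * ((|(n:ℝ)| + a^3) / a^6 * (120 * B^2 / a^6)) + 2 * B / a^3 / a^6 * ∑ j ∈ I, ‖g j‖ := by
            rw [Finset.sum_add_distrib, Finset.sum_const, nsmul_eq_mul, hcard, ← Finset.mul_sum]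
        _ ≤ _ := by gcongr
    have hk2 : (0:ℝ) < k + 1/2 := by positivity
    have hsq : 0 < Real.sqrt (2*k+1) := Real.sqrt_pos.2 (by positivity)
    have hsq2 := Real.sq_sqrt (show (0:ℝ) ≤ 2*k+1 by positivity)
    rw [abs_div, abs_of_pos hk2, div_le_iff₀ hk2]
    refine main.trans (le_of_eq ?_)
    have hk3 : (k:ℝ) + 1/2 = Real.sqrt (2*k+1)^2 / 2 := by rw [hsq2]; ring
    have hk4 : (2*k+1:ℝ) * ((|(n:ℝ)| + a^3) / a^6 * (120 * B^2 / a^6)) = Real.sqrt (2*k+1)^2 * ((|(n:ℝ)| + a^3) / a^6 * (120 * B^2 / a^6)) := by rw [hsq2]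
    rw [hk3, hk4]
    set z := Real.sqrt (2*k+1)
    field_simp
    ring
  refine (Finset.abs_sum_le_sum_abs _ _).trans ((Finset.sum_le_sum step).trans ?_)
  rw [Finset.sum_add_distrib, Finset.sum_const, nsmul_eq_mul, Finset.card_range, ← Finset.mul_sum]
  have hs : Real.sqrt L ≤ a^2 := by
    rw [Real.sqrt_le_iff]; refine ⟨by positivity, ?_⟩
    have : a^3 ≤ a^4 := pow_le_pow_right₀ ha (by norm_num)
    nlinarith
  calc _ ≤ 120 * B^2 / a^12 * a^6 + 4 * B^2 / a^8 * (2 * a^2) := by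
        refine add_le_add ?_ (by gcongr; exact (sum_inv_sqrt L).trans (by gcongr))
        calc _ = 120 * B^2 / a^12 * (L * (2 * (|(n:ℝ)| + a^3))) := by ring
          _ ≤ _ := by gcongr
    _ = 128 * B^2 / a^6 := by field_simp; norm_num
    _ ≤ _ := by gcongr; norm_num

end ALD

namespace ALD

variable {a B : ℝ} {v g : ℤ → ℂ}

lemma sum_Ico_split (n : ℤ) (L : ℕ) (F : ℤ → ℝ) :
    ∑ m ∈ Finset.Ico (n+1-L) (n+1+L), F m = ∑ k ∈ Finset.range L, (F (n-k) + F (n+k+1)) := by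
  induction L with
  | zero => simp
  | succ L ih =>
    rw [Finset.sum_range_succ, ← ih]
    have e : Finset.Ico (n+1-((L+1:ℕ):ℤ)) (n+1+((L+1:ℕ):ℤ)) = insert (n-L) (insert (n+L+1) (Finset.Ico (n+1-L) (n+1+L))) := by
      ext x; simp only [Finset.mem_insert, Finset.mem_Ico]; push_cast; omega
    rw [e, Finset.sum_insert, Finset.sum_insert]
    · ring
    · simp only [Finset.mem_Ico]; omega
    · simp only [Finset.mem_insert, Finset.mem_Ico]; omega

lemma Hyp.partial_bd (H : Hyp a B v g) (n : ℤ) : ∃ N0 : ℕ, ∀ N : ℕ, N0 ≤ N →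
    |∑ m ∈ Finset.Ico (n+1-(N:ℤ)) (n+1+N), y v m / kap n m| ≤ 8000200 * B^2 / a^6 := by
  have ha := H.ha
  have hM : 0 < |(n:ℝ)| + a^3 := by positivity
  set X := a^6 / (2 * (|(n:ℝ)| + a^3)) with hX
  have hX0 : 0 ≤ X := by positivity
  have hX8 : a^6 / (8 * (|(n:ℝ)| + a^3)) = X / 4 := by rw [hX]; field_simp; norm_num
  set L := ⌊X⌋₊ with hL
  have hL1 : (L:ℝ) ≤ X := Nat.floor_le hX0
  have hL2 : X < L + 1 := Nat.lt_floor_add_one X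
  have key : ∀ z : ℝ, (L:ℝ) - 1/2 ≤ |z| → 1/2 ≤ |z| → 1/2 ≤ |z| ∧ a^6 / (8 * (|(n:ℝ)| + a^3)) ≤ |z| := by
    intro z h1 h2
    refine ⟨h2, ?_⟩
    rw [hX8]
    linarith
  refine ⟨L, fun N hN => ?_⟩
  have hN' : (L:ℤ) ≤ N := by exact_mod_cast hN
  have s1 : ∑ m ∈ Finset.Ico (n+1-(N:ℤ)) (n+1+N), y v m / kap n m =
      ∑ m ∈ Finset.Ico (n+1-(N:ℤ)) (n+1-L), y v m / kap n m +
      ∑ m ∈ Finset.Ico (n+1-(L:ℤ)) (n+1+L), y v m / kap n m +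
      ∑ m ∈ Finset.Ico (n+1+(L:ℤ)) (n+1+N), y v m / kap n m := by
    have d1 : Finset.Ico (n+1-(N:ℤ)) (n+1+N) = (Finset.Ico (n+1-(N:ℤ)) (n+1-L) ∪ Finset.Ico (n+1-(L:ℤ)) (n+1+L)) ∪
        Finset.Ico (n+1+(L:ℤ)) (n+1+N) := by
      ext x; simp only [Finset.mem_union, Finset.mem_Ico]; omega
    rw [d1, Finset.sum_union, Finset.sum_union]
    · rw [Finset.disjoint_left]; intro x; simp only [Finset.mem_Ico]; omega
    · rw [Finset.disjoint_left]; intro x; simp only [Finset.mem_union, Finset.mem_Ico]; omega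
  have f1 := H.far n (n+1-N) (n+1-L) (by omega) (by
    intro m hm
    rw [Finset.mem_Icc] at hm
    have c : (m:ℝ) ≤ ((n+1-L:ℤ):ℝ) := by exact_mod_cast hm.2
    push_cast at c
    apply key
    · refine le_trans ?_ (le_abs_self _); rw [kap]; linarith
    · rcases le_or_gt m n with h | h
      · have : (m:ℝ) ≤ n := by exact_mod_cast h
        refine le_trans ?_ (le_abs_self _); rw [kap]; linarith
      · have : ((n+1:ℤ):ℝ) ≤ m := by exact_mod_cast h
        push_cast at this
        refine le_trans ?_ (neg_le_abs _); rw [kap]; linarith)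
  have f2 := H.far n (n+1+L) (n+1+N) (by omega) (by
    intro m hm
    rw [Finset.mem_Icc] at hm
    have c : ((n+1+L:ℤ):ℝ) ≤ m := by exact_mod_cast hm.1
    push_cast at c
    have : (0:ℝ) ≤ L := by positivity
    apply key
    · refine le_trans ?_ (neg_le_abs _); rw [kap]; linarith
    · refine le_trans ?_ (neg_le_abs _); rw [kap]; linarith)
  have f3 := H.near n L hL1
  rw [s1, sum_Ico_split]
  have e : ∑ k ∈ Finset.range L, (y v (n-k) / kap n (n-k) + y v (n+k+1) / kap n (n+k+1)) =
      ∑ k ∈ Finset.range L, (y v (n-k) - y v (n+k+1)) / ((k:ℝ) + 1/2) := by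
    refine Finset.sum_congr rfl fun k _ => ?_
    have h1 : kap n (n-k) = k + 1/2 := by rw [kap]; push_cast; ring
    have h2 : kap n (n+k+1) = -(k + 1/2) := by rw [kap]; push_cast; ring
    rw [h1, h2, div_neg, sub_div]; ring
  rw [e]
  refine (abs_add_le _ _).trans ((add_le_add ((abs_add_le _ _).trans (add_le_add f1 f3)) f2).trans (le_of_eq ?_))
  ring

lemma kap_abs (n m : ℤ) : 1/2 ≤ |kap n m| := by
  rcases le_or_gt m n with h | h
  · have : (m:ℝ) ≤ n := by exact_mod_cast h
    refine le_trans ?_ (le_abs_self _); rw [kap]; linarith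
  · have : ((n+1:ℤ):ℝ) ≤ m := by exact_mod_cast h
    push_cast at this
    refine le_trans ?_ (neg_le_abs _); rw [kap]; linarith

lemma Hyp.final (H : Hyp a B v g) (n : ℤ) :
    |∑' m : ℤ, ‖v m‖^2 * (sg (n-m) * (((n:ℝ)-m) / (((n:ℝ)-m)^2 - 1/4)))| ≤ 4000100 * B^2 / a^6 := by
  have hV : Summable (fun m : ℤ => ‖v m‖^2) :=
    summable_of_sum_le (fun _ => by positivity) H.v2
  have hV1 : Summable (fun m : ℤ => ‖v (m-1)‖^2) :=
    (Equiv.subRight (1:ℤ)).summable_iff.2 hV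
  have kb : ∀ m : ℤ, |sg m / kap n m| ≤ 2 := by
    intro m
    rw [abs_div, sg_abs]
    have := kap_abs n m
    rw [div_le_iff₀ (by linarith)]; linarith
  have hP : Summable (fun m : ℤ => ‖v m‖^2 * (sg m / kap n m)) := by
    refine Summable.of_norm_bounded (g := fun m => ‖v m‖^2 * 2) (hV.mul_right 2) fun m => ?_
    rw [norm_mul, Real.norm_eq_abs, Real.norm_eq_abs, abs_of_nonneg (by positivity)]
    gcongr; exact kb m
  have hQ : Summable (fun m : ℤ => ‖v (m-1)‖^2 * (sg m / kap n m)) := by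
    refine Summable.of_norm_bounded (g := fun m => ‖v (m-1)‖^2 * 2) (hV1.mul_right 2) fun m => ?_
    rw [norm_mul, Real.norm_eq_abs, Real.norm_eq_abs, abs_of_nonneg (by positivity)]
    gcongr; exact kb m
  have hY : HasSum (fun m : ℤ => y v m / kap n m) (∑' m : ℤ, ‖v m‖^2 * (sg m / kap n m) - ∑' m : ℤ, ‖v (m-1)‖^2 * (sg m / kap n m)) := by
    have := hP.hasSum.sub hQ.hasSum
    refine this.congr_fun ?_
    intro m; simp only [y, w]; ring
  have lim : |∑' m : ℤ, ‖v m‖^2 * (sg m / kap n m) - ∑' m : ℤ, ‖v (m-1)‖^2 * (sg m / kap n m)| ≤ 8000200 * B^2 / a^6 := by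
    obtain ⟨N0, hN⟩ := H.partial_bd n
    have ht : Filter.Tendsto (fun N : ℕ => Finset.Ico (n+1-(N:ℤ)) (n+1+N)) Filter.atTop Filter.atTop := by
      apply Filter.tendsto_atTop_finset_of_monotone
      · intro i k hik x
        simp only [Finset.mem_Ico]; omega
      · intro x
        refine ⟨(x - (n+1)).natAbs + 1, ?_⟩
        simp only [Finset.mem_Ico]; omega
    refine le_of_tendsto ((hY.comp ht).abs) ?_
    filter_upwards [Filter.eventually_ge_atTop N0] with N h
    exact hN N h
  have sh : ∑' m : ℤ, ‖v (m-1)‖^2 * (sg m / kap n m) = ∑' m : ℤ, ‖v m‖^2 * (-sg m / kap n (m+1)) := by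
    rw [← (Equiv.addRight (1:ℤ)).tsum_eq]
    refine tsum_congr fun m => ?_
    simp only [Equiv.coe_addRight, add_sub_cancel_right, sg_succ]
  have hQ' : Summable (fun m : ℤ => ‖v m‖^2 * (-sg m / kap n (m+1))) := by
    rw [← (Equiv.addRight (1:ℤ)).summable_iff] at hQ
    refine hQ.congr fun m => ?_
    simp only [Function.comp, Equiv.coe_addRight, add_sub_cancel_right, sg_succ]
  rw [sh, ← hP.tsum_sub hQ'] at lim
  have fin : ∑' m : ℤ, ‖v m‖^2 * (sg (n-m) * (((n:ℝ)-m) / (((n:ℝ)-m)^2 - 1/4))) =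
      sg n / 2 * ∑' m : ℤ, (‖v m‖^2 * (sg m / kap n m) - ‖v m‖^2 * (-sg m / kap n (m+1))) := by
    rw [← tsum_mul_left]
    refine tsum_congr fun m => ?_
    have h1 : kap n m ≠ 0 := by
      intro h; have := kap_abs n m; rw [h] at this; norm_num at this
    have h2 : kap n (m+1) ≠ 0 := by
      intro h; have := kap_abs n (m+1); rw [h] at this; norm_num at this
    have h3 : ((n:ℝ)-m)^2 - 1/4 = kap n m * kap n (m+1) := by simp only [kap]; push_cast; ring
    have h4 : sg (n-m) = sg n * sg m := by
      simp only [sg]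
      rw [zpow_sub₀ (by norm_num), div_eq_mul_inv, ← inv_zpow]; norm_num
    have h5 : ((n:ℝ)-m) = (kap n m + kap n (m+1))/2 := by simp only [kap]; push_cast; ring
    rw [h4, h3, h5]
    field_simp
    ring
  rw [fin, abs_mul, abs_div, sg_abs]
  norm_num
  linarith [show 4000100 * B^2 / a^6 = 1/2 * (8000200 * B^2 / a^6) by ring]

end ALD

namespace ALD
open MeasureTheory Complex

noncomputable def E (n : ℤ) (ξ : ℝ) : ℂ := Complex.exp (Complex.I * (n : ℂ) * (ξ : ℂ))

lemma E_norm (n : ℤ) (ξ : ℝ) : ‖E n ξ‖ = 1 := by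
  rw [E, show Complex.I * (n:ℂ) * (ξ:ℂ) = ((n * ξ : ℝ):ℂ) * Complex.I by push_cast; ring]
  exact Complex.norm_exp_ofReal_mul_I _

lemma E_cont (n : ℤ) : Continuous (E n) := by unfold E; fun_prop

lemma E_deriv (n : ℤ) (ξ : ℝ) : HasDerivAt (E n) (Complex.I * n * E n ξ) ξ := by
  have h : HasDerivAt (fun ξ : ℝ => Complex.I * (n:ℂ) * (ξ:ℂ)) (Complex.I * n) ξ := by
    simpa using (Complex.ofRealCLM.hasDerivAt (x := ξ)).const_mul (Complex.I * (n:ℂ))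
  have := h.cexp
  unfold E
  convert this using 1
  ring

lemma E_add (n m : ℤ) (ξ : ℝ) : E (n+m) ξ = E n ξ * E m ξ := by
  simp only [E]; rw [← Complex.exp_add]; congr 1; push_cast; ring

lemma E_neg (n : ℤ) (ξ : ℝ) : E (-n) ξ = (starRingEnd ℂ) (E n ξ) := by
  simp only [E]; rw [← Complex.exp_conj]; congr 1; simp

lemma E_pi (n : ℤ) : E n Real.pi = E n (-Real.pi) := by
  simp only [E]
  rw [Complex.exp_eq_exp_iff_exists_int]
  exact ⟨n, by push_cast; ring⟩

lemma E_int (n : ℤ) (hn : n ≠ 0) : ∫ ξ in (-Real.pi)..Real.pi, E n ξ = 0 := by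
  have hd : ∀ ξ ∈ Set.uIcc (-Real.pi) Real.pi, HasDerivAt (fun ξ => (Complex.I * n)⁻¹ * E n ξ) (E n ξ) ξ := by
    intro ξ _
    have h0 : Complex.I * (n:ℂ) ≠ 0 := mul_ne_zero Complex.I_ne_zero (by exact_mod_cast hn)
    have := (E_deriv n ξ).const_mul (Complex.I * (n:ℂ))⁻¹
    rwa [← mul_assoc, inv_mul_cancel₀ h0, one_mul] at this
  rw [intervalIntegral.integral_eq_sub_of_hasDerivAt hd ((E_cont n).intervalIntegrable _ _), E_pi, sub_self]

lemma E_int0 : ∫ ξ in (-Real.pi)..Real.pi, E 0 ξ = 2 * Real.pi := by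
  simp [E]; ring

lemma bessel (h : ℝ → ℂ) (hc : Continuous h) (s : Finset ℤ) :
    ∑ n ∈ s, ‖∫ ξ in (-Real.pi)..Real.pi, h ξ * E n ξ‖^2 ≤ 2 * Real.pi * ∫ ξ in (-Real.pi)..Real.pi, ‖h ξ‖^2 := by
  have hab : -Real.pi < Real.pi := by linarith [Real.pi_pos]
  have hm : MemLp h 2 (volume.restrict (Set.Ioc (-Real.pi) Real.pi)) := by
    obtain ⟨M, hM⟩ := (isCompact_Icc (a := -Real.pi) (b := Real.pi)).exists_bound_of_continuousOn hc.continuousOn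
    refine MemLp.of_bound hc.aestronglyMeasurable M ?_
    filter_upwards [ae_restrict_mem measurableSet_Ioc] with x hx
    exact hM x (Set.Ioc_subset_Icc_self hx)
  have hs := hasSum_sq_fourierCoeffOn hab hm
  have e : ∀ n : ℤ, ∫ ξ in (-Real.pi)..Real.pi, h ξ * E n ξ = (2 * Real.pi : ℝ) • fourierCoeffOn hab h (-n) := by
    intro n
    rw [fourierCoeffOn_eq_integral, smul_smul, show (2 * Real.pi) * (1 / (Real.pi - -Real.pi)) = 1 by field_simp; ring, one_smul]
    refine intervalIntegral.integral_congr fun ξ _ => ?_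
    simp only [neg_neg, fourier_coe_apply, E, smul_eq_mul]
    rw [mul_comm]
    congr 2
    have : (Real.pi:ℂ) ≠ 0 := by exact_mod_cast Real.pi_ne_zero
    push_cast
    field_simp
    ring
  have hs' : HasSum (fun n => ‖∫ ξ in (-Real.pi)..Real.pi, h ξ * E n ξ‖^2) (2 * Real.pi * ∫ ξ in (-Real.pi)..Real.pi, ‖h ξ‖^2) := by
    have h1 := ((Equiv.neg ℤ).hasSum_iff.2 hs).mul_left ((2*Real.pi)^2)
    have z : HasSum (fun n => ‖∫ ξ in (-Real.pi)..Real.pi, h ξ * E n ξ‖^2) _ := h1.congr_fun (fun n => by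
      simp only [e, norm_smul, mul_pow, Function.comp, Equiv.neg_apply, Real.norm_eq_abs, sq_abs])
    · convert z using 1
      rw [smul_eq_mul]
      have := Real.pi_pos
      rw [sub_neg_eq_add, ← two_mul]
      field_simp
  exact sum_le_hasSum s (fun _ _ => by positivity) hs'

lemma swap (φ : ℝ → ℂ) (hc : Continuous φ) (c : ℤ → ℂ) (hs : Summable (fun k => ‖c k‖)) :
    HasSum (fun k => c k * ∫ ξ in (-Real.pi)..Real.pi, φ ξ * E k ξ)
      (∫ ξ in (-Real.pi)..Real.pi, φ ξ * ∑' k, c k * E k ξ) := by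
  have := intervalIntegral.hasSum_integral_of_dominated_convergence (μ := volume) (a := -Real.pi) (b := Real.pi)
    (F := fun k ξ => c k * (φ ξ * E k ξ)) (f := fun ξ => φ ξ * ∑' k, c k * E k ξ)
    (fun k ξ => ‖c k‖ * ‖φ ξ‖) ?_ ?_ ?_ ?_ ?_
  · simpa only [intervalIntegral.integral_const_mul] using this
  · intro k
    have := E_cont k
    exact (by fun_prop : Continuous _).aestronglyMeasurable
  · intro k; filter_upwards with ξ _
    simp [E_norm]
  · filter_upwards with ξ _; exact hs.mul_right _
  · simp_rw [tsum_mul_right]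
    exact (by fun_prop : Continuous _).intervalIntegrable _ _
  · filter_upwards with ξ _
    have : Summable (fun k => c k * E k ξ) := Summable.of_norm (by simpa [E_norm] using hs)
    have := this.hasSum.mul_left (φ ξ)
    refine this.congr_fun fun k => ?_
    ring

lemma ibp (h h' : ℝ → ℂ) (hd : ∀ ξ, HasDerivAt h (h' ξ) ξ) (hc : Continuous h') (hp : h Real.pi = h (-Real.pi)) (k : ℤ) :
    ∫ ξ in (-Real.pi)..Real.pi, h' ξ * E k ξ = - (Complex.I * k) * ∫ ξ in (-Real.pi)..Real.pi, h ξ * E k ξ := by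
  have hE := E_cont k
  have hh : Continuous h := continuous_iff_continuousAt.2 fun ξ => (hd ξ).continuousAt
  have := intervalIntegral.integral_mul_deriv_eq_deriv_mul (a := -Real.pi) (b := Real.pi) (u := h) (v := E k) (u' := h')
    (v' := fun ξ => Complex.I * k * E k ξ) (fun ξ _ => hd ξ) (fun ξ _ => E_deriv k ξ)
    (hc.intervalIntegrable _ _) ((by fun_prop : Continuous _).intervalIntegrable _ _)
  rw [hp, E_pi, sub_self, zero_sub] at this
  rw [neg_eq_iff_eq_neg.1 this.symm, neg_mul, ← intervalIntegral.integral_const_mul]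
  congr 1
  refine intervalIntegral.integral_congr fun ξ _ => ?_
  ring

structure Dat (f : ℤ → ℂ) (A K : ℝ) : Prop where
  hA : 0 ≤ A
  hK : 0 ≤ K
  bd : ∀ ξ, ‖discFT f ξ‖ ≤ A
  sm : Summable (fun n : ℤ => (n : ℝ) ^ 2 * ‖f n‖ ^ 2)
  le : ∑' n : ℤ, (n : ℝ) ^ 2 * ‖f n‖ ^ 2 ≤ K^2

variable {f : ℤ → ℂ} {A K : ℝ}

lemma Dat.l1 (H : Dat f A K) : Summable (fun n => ‖f n‖) := by
  have h2 : Summable (fun n : ℤ => 1 / (n:ℝ)^2) := Real.summable_one_div_int_pow.2 (by norm_num)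
  have h3 := h2.add H.sm
  have : Summable (fun n : ℤ => (1 / (n:ℝ)^2 + (n : ℝ) ^ 2 * ‖f n‖ ^ 2) + if n = 0 then ‖f 0‖ else 0) := by
    refine h3.add ?_
    exact summable_of_ne_finset_zero (s := {0}) (by intro b hb; simp at hb; simp [hb])
  refine Summable.of_nonneg_of_le (fun _ => norm_nonneg _) (fun n => ?_) this
  rcases eq_or_ne n 0 with rfl | hn
  · simp
  · have : (n:ℝ) ≠ 0 := by exact_mod_cast hn
    simp only [hn, if_false, add_zero]
    have h5 : 0 ≤ (1/|(n:ℝ)| - |(n:ℝ)| * ‖f n‖)^2 := sq_nonneg _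
    have h6 : |(n:ℝ)| ≠ 0 := by simpa using this
    have h7 : (1/|(n:ℝ)| - |(n:ℝ)| * ‖f n‖)^2 = 1/(n:ℝ)^2 + (n:ℝ)^2*‖f n‖^2 - 2 * ‖f n‖ := by
      rw [← sq_abs (n:ℝ)]; field_simp; ring
    linarith [norm_nonneg (f n)]

noncomputable def cst : ℝ := (Real.sqrt (2 * Real.pi))⁻¹
lemma cst_pos : 0 < cst := by unfold cst; have := Real.pi_pos; positivity
lemma cst_sq : cst^2 * (2 * Real.pi) = 1 := by
  have := Real.pi_pos
  rw [cst, inv_pow, Real.sq_sqrt (by positivity)]; field_simp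

lemma discFT_eq (f : ℤ → ℂ) (ξ : ℝ) : discFT f ξ = (cst:ℂ) * ∑' n, f n * E n ξ := by
  simp only [discFT, E, cst]; push_cast; rfl

lemma Dat.cont (H : Dat f A K) : Continuous (discFT f) := by
  have : discFT f = fun ξ => (cst:ℂ) * ∑' n, f n * E n ξ := funext (discFT_eq f)
  rw [this]
  refine continuous_const.mul (continuous_tsum (fun n => continuous_const.mul (E_cont n)) H.l1 fun n ξ => ?_)
  simp [E_norm]

lemma Dat.toolB (H : Dat f A K) (h h' : ℝ → ℂ) (hd : ∀ ξ, HasDerivAt h (h' ξ) ξ) (hc : Continuous h')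
    (hp : h Real.pi = h (-Real.pi)) :
    ‖∫ ξ in (-Real.pi)..Real.pi, h' ξ * discFT f ξ‖ ≤ K * Real.sqrt (∫ ξ in (-Real.pi)..Real.pi, ‖h ξ‖^2) := by
  have hh : Continuous h := continuous_iff_continuousAt.2 fun ξ => (hd ξ).continuousAt
  have hs := (swap h' hc f H.l1).mul_left (cst:ℂ)
  have e : ∫ ξ in (-Real.pi)..Real.pi, h' ξ * discFT f ξ = cst * ∫ ξ in (-Real.pi)..Real.pi, h' ξ * ∑' k, f k * E k ξ := by
    rw [← intervalIntegral.integral_const_mul]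
    refine intervalIntegral.integral_congr fun ξ _ => ?_
    simp only [discFT_eq]; ring
  rw [e]
  refine le_of_tendsto hs.norm (Filter.Eventually.of_forall fun s => ?_)
  rw [← Finset.mul_sum]
  have hcs := Real.sum_mul_le_sqrt_mul_sqrt s (fun k => |(k:ℝ)| * ‖f k‖) (fun k => ‖∫ ξ in (-Real.pi)..Real.pi, h ξ * E k ξ‖)
  have b1 : ∑ k ∈ s, (|(k:ℝ)| * ‖f k‖)^2 ≤ K^2 := by
    refine le_trans (le_of_eq ?_) ((H.sm.sum_le_tsum s (fun _ _ => by positivity)).trans H.le)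
    exact Finset.sum_congr rfl fun k _ => by rw [mul_pow, sq_abs]
  have b2 := bessel h hh s
  have hc0 := cst_pos
  calc ‖(cst:ℂ) * ∑ k ∈ s, f k * ∫ ξ in (-Real.pi)..Real.pi, h' ξ * E k ξ‖
      = cst * ‖∑ k ∈ s, f k * ∫ ξ in (-Real.pi)..Real.pi, h' ξ * E k ξ‖ := by
        rw [norm_mul, Complex.norm_real, Real.norm_of_nonneg hc0.le]
    _ ≤ cst * ∑ k ∈ s, |(k:ℝ)| * ‖f k‖ * ‖∫ ξ in (-Real.pi)..Real.pi, h ξ * E k ξ‖ := by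
        gcongr
        refine (norm_sum_le _ _).trans (Finset.sum_le_sum fun k _ => le_of_eq ?_)
        rw [ibp h h' hd hc hp]
        simp only [norm_mul, norm_neg, Complex.norm_I, one_mul, Complex.norm_intCast]
        ring
    _ ≤ cst * (K * (Real.sqrt (2 * Real.pi) * Real.sqrt (∫ ξ in (-Real.pi)..Real.pi, ‖h ξ‖^2))) := by
        gcongr
        refine hcs.trans ?_
        gcongr
        · exact H.hK
        · exact Real.sqrt_le_iff.2 ⟨H.hK, b1⟩
        · rw [← Real.sqrt_mul (by positivity)]
          exact Real.sqrt_le_sqrt b2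
    _ = _ := by
        have : cst * Real.sqrt (2*Real.pi) = 1 := by
          rw [cst]; exact inv_mul_cancel₀ (by have := Real.pi_pos; positivity)
        linear_combination (K * Real.sqrt (∫ ξ in (-Real.pi)..Real.pi, ‖h ξ‖^2)) * this

end ALD

namespace ALD
open MeasureTheory Complex
variable {f : ℤ → ℂ} {A K : ℝ}

noncomputable def ph (t : ℝ) (ξ : ℝ) : ℂ := Complex.exp (((2 * t * Real.cos ξ : ℝ) : ℂ) * Complex.I)
noncomputable def hh (t : ℝ) (n : ℤ) (ξ : ℝ) : ℂ := ph t ξ * E (-n) ξ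
noncomputable def hd (t : ℝ) (n : ℤ) (ξ : ℝ) : ℂ := ((-(2 * t * Real.sin ξ + n) : ℝ) : ℂ) * Complex.I * hh t n ξ

lemma ph_norm (t ξ : ℝ) : ‖ph t ξ‖ = 1 := Complex.norm_exp_ofReal_mul_I _
lemma ph_cont (t : ℝ) : Continuous (ph t) := by unfold ph; fun_prop
lemma hh_norm (t : ℝ) (n : ℤ) (ξ : ℝ) : ‖hh t n ξ‖ = 1 := by simp [hh, ph_norm, E_norm]
lemma hh_cont (t : ℝ) (n : ℤ) : Continuous (hh t n) := (ph_cont t).mul (E_cont _)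
lemma hd_cont (t : ℝ) (n : ℤ) : Continuous (hd t n) := by
  have := hh_cont t n; unfold hd; fun_prop
lemma hh_pi (t : ℝ) (n : ℤ) : hh t n Real.pi = hh t n (-Real.pi) := by
  simp only [hh, ph, E_pi, Real.cos_neg]
lemma hh_deriv (t : ℝ) (n : ℤ) (ξ : ℝ) : HasDerivAt (hh t n) (hd t n ξ) ξ := by
  have h1 : HasDerivAt (fun ξ : ℝ => (2 * t * Real.cos ξ : ℝ)) (2 * t * (- Real.sin ξ)) ξ :=
    (Real.hasDerivAt_cos ξ).const_mul _
  have h2 := ((h1.ofReal_comp).mul_const Complex.I).cexp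
  have h3 := h2.mul (E_deriv (-n) ξ)
  unfold hh hd
  refine h3.congr_deriv ?_
  simp only [hh, ph]
  push_cast
  ring

lemma alProp_eq (f : ℤ → ℂ) (t : ℝ) (n : ℤ) :
    alProp f t n = (cst:ℂ) * ∫ ξ in (-Real.pi)..Real.pi, hh t n ξ * discFT f ξ := by
  simp only [alProp, cst]
  push_cast
  congr 1
  refine intervalIntegral.integral_congr fun ξ _ => ?_
  simp only [hh, ph, E]
  push_cast
  rw [show -(Complex.I * (n:ℂ) * ξ) = Complex.I * -(n:ℂ) * ξ by ring]
  ring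

lemma Dat.u2 (H : Dat f A K) (t : ℝ) (s : Finset ℤ) : ∑ n ∈ s, ‖alProp f t n‖^2 ≤ 2 * Real.pi * A^2 := by
  have hF := H.cont
  have hp := ph_cont t
  have hc : Continuous (fun ξ => ph t ξ * discFT f ξ) := hp.mul hF
  have hb := bessel _ hc (s.map (Equiv.neg ℤ).toEmbedding)
  rw [Finset.sum_map] at hb
  have e : ∀ n, ‖alProp f t n‖^2 = cst^2 * ‖∫ ξ in (-Real.pi)..Real.pi, (ph t ξ * discFT f ξ) * E ((Equiv.neg ℤ).toEmbedding n) ξ‖^2 := by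
    intro n
    rw [alProp_eq, norm_mul, mul_pow, Complex.norm_real, Real.norm_eq_abs, sq_abs]
    congr 3
    refine intervalIntegral.integral_congr fun ξ _ => ?_
    simp [hh]; ring
  simp_rw [e]
  rw [← Finset.mul_sum]
  have hi : ∫ ξ in (-Real.pi)..Real.pi, ‖ph t ξ * discFT f ξ‖^2 ≤ ∫ ξ in (-Real.pi)..Real.pi, A^2 := by
    refine intervalIntegral.integral_mono_on (by linarith [Real.pi_pos]) ((hc.norm.pow 2).intervalIntegrable _ _) intervalIntegrable_const ?_
    intro ξ _
    rw [norm_mul, ph_norm, one_mul]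
    exact pow_le_pow_left₀ (norm_nonneg _) (H.bd ξ) 2
  have hpi := Real.pi_pos
  calc _ ≤ cst^2 * (2 * Real.pi * ∫ ξ in (-Real.pi)..Real.pi, A^2) := by gcongr; exact hb.trans (by gcongr)
    _ = cst^2 * (2 * Real.pi) * (2 * Real.pi * A^2) := by
      rw [intervalIntegral.integral_const, smul_eq_mul]; ring
    _ = _ := by rw [cst_sq, one_mul]

noncomputable def gt (f : ℤ → ℂ) (t : ℝ) (n : ℤ) : ℂ :=
  Complex.I * cst * ∫ ξ in (-Real.pi)..Real.pi, hd t n ξ * discFT f ξ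

lemma hd_eq (t : ℝ) (n : ℤ) (ξ : ℝ) :
    Complex.I * hd t n ξ = (n:ℂ) * hh t n ξ - Complex.I * t * (hh t (n-1) ξ - hh t (n+1) ξ) := by
  have h1 : hh t (n-1) ξ = hh t n ξ * E 1 ξ := by
    simp only [hh]; rw [show -(n-1) = -n + 1 by ring, E_add]; ring
  have h2 : hh t (n+1) ξ = hh t n ξ * E (-1) ξ := by
    simp only [hh]; rw [show -(n+1) = -n + -1 by ring, E_add]; ring
  have h3 : E 1 ξ - E (-1) ξ = 2 * Complex.I * (Real.sin ξ : ℝ) := by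
    simp only [E]
    push_cast
    rw [show Complex.I * (1:ℂ) * ξ = ξ * Complex.I by ring, show Complex.I * (-1:ℂ) * ξ = -ξ * Complex.I by ring,
      Complex.sin]
    linear_combination (-1) * (Complex.exp (-ξ * Complex.I) - Complex.exp (ξ * Complex.I)) * Complex.I_sq
  rw [h1, h2, ← mul_sub, h3, hd]
  push_cast
  linear_combination (- n * hh t n ξ) * Complex.I_sq

lemma Dat.recu (H : Dat f A K) (t : ℝ) (n : ℤ) :
    (n:ℂ) * alProp f t n = Complex.I * t * (alProp f t (n-1) - alProp f t (n+1)) + gt f t n := by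
  have hF := H.cont
  have i1 : ∀ k, IntervalIntegrable (fun ξ => hh t k ξ * discFT f ξ) volume (-Real.pi) Real.pi := fun k =>
    ((hh_cont t k).mul hF).intervalIntegrable _ _
  have : Complex.I * ∫ ξ in (-Real.pi)..Real.pi, hd t n ξ * discFT f ξ =
      (n:ℂ) * (∫ ξ in (-Real.pi)..Real.pi, hh t n ξ * discFT f ξ) - Complex.I * t * ((∫ ξ in (-Real.pi)..Real.pi, hh t (n-1) ξ * discFT f ξ)
        - ∫ ξ in (-Real.pi)..Real.pi, hh t (n+1) ξ * discFT f ξ) := by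
    rw [← intervalIntegral.integral_sub (i1 _) (i1 _), ← intervalIntegral.integral_const_mul, ← intervalIntegral.integral_const_mul,
      ← intervalIntegral.integral_const_mul, ← intervalIntegral.integral_sub ((i1 _).const_mul _) (((i1 _).sub (i1 _)).const_mul _)]
    refine intervalIntegral.integral_congr fun ξ _ => ?_
    have := hd_eq t n ξ
    linear_combination discFT f ξ * this
  rw [gt, alProp_eq, alProp_eq, alProp_eq]
  linear_combination (-cst:ℂ) * this

lemma trig_norm (s : Finset ℤ) (c : ℤ → ℂ) :
    ∫ ξ in (-Real.pi)..Real.pi, ‖∑ n ∈ s, c n * E (-n) ξ‖^2 = 2 * Real.pi * ∑ n ∈ s, ‖c n‖^2 := by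
  have hE := E_cont
  have key : ∫ ξ in (-Real.pi)..Real.pi, ((‖∑ n ∈ s, c n * E (-n) ξ‖^2 : ℝ):ℂ) = ((2 * Real.pi * ∑ n ∈ s, ‖c n‖^2 : ℝ):ℂ) := by
    have e : ∀ ξ, ((‖∑ n ∈ s, c n * E (-n) ξ‖^2 : ℝ):ℂ) = ∑ n ∈ s, ∑ m ∈ s, (c n * (starRingEnd ℂ) (c m)) * E (m - n) ξ := by
      intro ξ
      push_cast
      rw [← Complex.mul_conj', map_sum, Finset.sum_mul_sum]
      refine Finset.sum_congr rfl fun n _ => Finset.sum_congr rfl fun m _ => ?_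
      rw [map_mul, ← E_neg, neg_neg, sub_eq_add_neg, E_add]; ring
    simp_rw [e]
    rw [intervalIntegral.integral_finsetSum (fun n _ => (by fun_prop : Continuous _).intervalIntegrable _ _)]
    push_cast
    rw [Finset.mul_sum]
    refine Finset.sum_congr rfl fun n hn => ?_
    rw [intervalIntegral.integral_finsetSum (fun n _ => (by fun_prop : Continuous _).intervalIntegrable _ _)]
    rw [Finset.sum_eq_single n]
    · rw [intervalIntegral.integral_const_mul, sub_self, E_int0, Complex.mul_conj']; ring
    · intro m _ hm
      rw [intervalIntegral.integral_const_mul, E_int _ (sub_ne_zero.2 hm), mul_zero]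
    · exact fun h => absurd hn h
  rw [intervalIntegral.integral_ofReal] at key
  exact_mod_cast key

lemma Dat.g2 (H : Dat f A K) (t : ℝ) (s : Finset ℤ) : ∑ n ∈ s, ‖gt f t n‖^2 ≤ K^2 := by
  have hF := H.cont
  set c : ℤ → ℂ := fun n => (starRingEnd ℂ) (gt f t n) with hc
  have hB := H.toolB (fun ξ => ∑ n ∈ s, c n * hh t n ξ) (fun ξ => ∑ n ∈ s, c n * hd t n ξ)
    (fun ξ => HasDerivAt.fun_sum fun n _ => (hh_deriv t n ξ).const_mul (c n))
    (continuous_finsetSum _ fun n _ => continuous_const.mul (hd_cont t n))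
    (Finset.sum_congr rfl fun n _ => by rw [hh_pi])
  have e1 : ∀ ξ, ‖∑ n ∈ s, c n * hh t n ξ‖^2 = ‖∑ n ∈ s, c n * E (-n) ξ‖^2 := by
    intro ξ
    have : ∑ n ∈ s, c n * hh t n ξ = ph t ξ * ∑ n ∈ s, c n * E (-n) ξ := by
      rw [Finset.mul_sum]; exact Finset.sum_congr rfl fun n _ => by rw [hh]; ring
    rw [this, norm_mul, ph_norm, one_mul]
  simp_rw [e1] at hB
  rw [trig_norm] at hB
  have e2 : ((∑ n ∈ s, ‖gt f t n‖^2 : ℝ):ℂ) = Complex.I * cst * ∫ ξ in (-Real.pi)..Real.pi, (∑ n ∈ s, c n * hd t n ξ) * discFT f ξ := by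
    simp_rw [Finset.sum_mul]
    rw [intervalIntegral.integral_finsetSum (fun n _ => (by have := hd_cont t n; fun_prop : Continuous (fun ξ => c n * hd t n ξ * discFT f ξ)).intervalIntegrable _ _), Finset.mul_sum]
    push_cast
    refine Finset.sum_congr rfl fun n _ => ?_
    rw [← Complex.conj_mul']
    simp_rw [mul_assoc (c n)]
    rw [intervalIntegral.integral_const_mul]
    simp only [hc]
    conv_lhs => rw [gt]
    rw [gt]
    ring
  set G := ∑ n ∈ s, ‖gt f t n‖^2 with hG
  have hG0 : 0 ≤ G := Finset.sum_nonneg fun _ _ => by positivity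
  have hG1 : ∑ n ∈ s, ‖c n‖^2 = G := by simp [hc, hG]
  rw [hG1] at hB
  have e3 : G ≤ K * Real.sqrt G := by
    have h1 : G = ‖((G:ℝ):ℂ)‖ := by rw [Complex.norm_real, Real.norm_of_nonneg hG0]
    suffices h2 : ‖((G:ℝ):ℂ)‖ ≤ K * Real.sqrt G by rwa [← h1] at h2
    rw [e2, norm_mul, norm_mul, Complex.norm_I, one_mul, Complex.norm_real, Real.norm_of_nonneg cst_pos.le]
    have : cst * Real.sqrt (2*Real.pi) = 1 := by
      rw [cst]; exact inv_mul_cancel₀ (by have := Real.pi_pos; positivity)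
    rw [Real.sqrt_mul (by have := Real.pi_pos; positivity)] at hB
    calc _ ≤ cst * (K * (Real.sqrt (2 * Real.pi) * Real.sqrt G)) := mul_le_mul_of_nonneg_left hB cst_pos.le
      _ = K * Real.sqrt G := by linear_combination (K * Real.sqrt G) * this
  have h4 := Real.sq_sqrt hG0
  have h5 := Real.sqrt_nonneg G
  have hK := H.hK
  rcases eq_or_lt_of_le h5 with h | h
  · rw [← h] at e3; nlinarith [sq_nonneg K]
  · have : Real.sqrt G ≤ K := by nlinarith
    nlinarith

end ALD

namespace ALD
open MeasureTheory

lemma sin_ge (z : ℝ) (h0 : 0 ≤ z) (h1 : z ≤ 3 * Real.pi / 4) : z / 5 ≤ Real.sin z := by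
  have hp := Real.pi_pos
  have hp4 := Real.pi_lt_four
  have key : ∀ y, 0 ≤ y → y ≤ Real.pi / 2 → y / 2 ≤ Real.sin y := by
    intro y hy0 hy1
    have := Real.mul_le_sin hy0 hy1
    have h2 : (1:ℝ)/2 ≤ 2 / Real.pi := by rw [div_le_div_iff₀ (by norm_num) hp]; linarith
    nlinarith
  rcases le_or_gt z (Real.pi/2) with h | h
  · linarith [key z h0 h]
  · have := key (Real.pi - z) (by linarith) (by linarith)
    rw [Real.sin_pi_sub] at this
    have h3 := Real.pi_lt_d2
    have h4 := Real.mul_le_sin (x := Real.pi - z) (by linarith) (by linarith)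
    rw [Real.sin_pi_sub] at h4
    have : 2 / Real.pi * (Real.pi - z) ≥ 2 / Real.pi * (Real.pi / 4) := by
      gcongr; linarith
    have h5 : 2 / Real.pi * (Real.pi / 4) = 1/2 := by field_simp; norm_num
    linarith

lemma ptwise (X b ρ θ : ℝ) (hX : 0 ≤ X) (hb : 0 ≤ b) (hρ : b ≤ ρ) (hθ : θ^2 = b + |2 - X|) :
    ∃ s0 : ℝ, ∀ s, 0 ≤ s → s ≤ Real.pi → θ^2 * (s - s0)^2 + ρ^2 ≤ 2500 * ((X - 2 * Real.cos s)^2 + ρ^2) := by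
  have hp := Real.pi_pos
  have hbρ : b^2 ≤ ρ^2 := by gcongr
  rcases le_or_gt X 2 with h | h
  · refine ⟨Real.arccos (X/2), fun s hs0 hs1 => ?_⟩
    set s0 := Real.arccos (X/2) with hs
    have c0 : Real.cos s0 = X/2 := Real.cos_arccos (by linarith) (by linarith)
    have p0 : 0 ≤ s0 := Real.arccos_nonneg _
    have p1 : s0 ≤ Real.pi/2 := Real.arccos_le_pi_div_two.2 (by linarith)
    rw [abs_of_nonneg (by linarith)] at hθ
    have q := Real.one_sub_sq_div_two_le_cos (x := s0)
    have id : X - 2 * Real.cos s = 4 * (Real.sin ((s + s0)/2) * Real.sin ((s - s0)/2)) := by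
      have := Real.cos_sub_cos s0 s
      rw [c0] at this
      have e : Real.sin ((s0 - s)/2) = - Real.sin ((s - s0)/2) := by
        rw [← Real.sin_neg]; congr 1; ring
      rw [e, add_comm s0 s] at this
      linarith
    have d1 : (s+s0)/2/5 ≤ Real.sin ((s+s0)/2) := sin_ge _ (by linarith) (by linarith)
    have d2 : |s-s0|/2/5 ≤ |Real.sin ((s-s0)/2)| := by
      have d3 : |s-s0|/2/5 ≤ Real.sin (|s-s0|/2) := by
        apply sin_ge _ (by positivity)
        have : |s - s0| ≤ Real.pi := by rw [abs_le]; constructor <;> linarith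
        linarith
      refine d3.trans ?_
      rcases abs_cases (s-s0) with ⟨h1,_⟩ | ⟨h1,_⟩ <;> rw [h1]
      · exact le_abs_self _
      · rw [neg_div, Real.sin_neg]; exact neg_le_abs _
    have low : (s+s0) * |s-s0| / 25 ≤ |X - 2 * Real.cos s| := by
      rw [id, abs_mul, abs_mul, abs_of_pos (by norm_num : (0:ℝ) < 4)]
      have : (s+s0)/2/5 * (|s-s0|/2/5) ≤ |Real.sin ((s+s0)/2)| * |Real.sin ((s-s0)/2)| := by
        gcongr; exact d1.trans (le_abs_self _)
      linarith
    have low2 : ((s+s0) * |s-s0| / 25)^2 ≤ (X - 2 * Real.cos s)^2 := by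
      rw [← sq_abs (X - _)]; gcongr
    have e2 : ((s+s0) * |s-s0| / 25)^2 = (s+s0)^2 * (s-s0)^2 / 625 := by
      rw [div_pow, mul_pow, sq_abs]; norm_num
    rw [e2] at low2
    set y := (s-s0)^2 with hy
    have hy0 : 0 ≤ y := sq_nonneg _
    have y1 : y ≤ (s+s0)^2 := by rw [hy]; nlinarith
    have y2 : s0^2 ≤ (s+s0)^2 := by nlinarith
    have y3 : b * y ≤ b^2 + y^2 := by nlinarith [sq_nonneg (b-y), mul_nonneg hb hy0]
    have y4 : y * y ≤ (s+s0)^2 * y := by gcongr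
    have y5 : s0^2 * y ≤ (s+s0)^2 * y := by gcongr
    have y6 : (2 - X) * y ≤ s0^2 * y := by
      apply mul_le_mul_of_nonneg_right _ hy0
      rw [c0] at q; linarith
    rw [hθ]
    nlinarith [sq_nonneg ρ]
  · refine ⟨0, fun s hs0 hs1 => ?_⟩
    rw [abs_of_neg (by linarith)] at hθ
    have q := Real.cos_le_one_sub_mul_cos_sq (x := s) (by rw [abs_of_nonneg hs0]; exact hs1)
    have q2 : (1:ℝ)/8 ≤ 2 / Real.pi^2 := by
      rw [div_le_div_iff₀ (by norm_num) (by positivity)]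
      nlinarith [Real.pi_lt_four]
    have q3 : 1/8 * s^2 ≤ 2 / Real.pi^2 * s^2 := by gcongr
    have low : (X - 2) + s^2/4 ≤ X - 2 * Real.cos s := by linarith
    have low2 : ((X - 2) + s^2/4)^2 ≤ (X - 2 * Real.cos s)^2 := by
      apply pow_le_pow_left₀ _ low; nlinarith [sq_nonneg s]
    rw [hθ, sub_zero]
    set y := s^2
    have hy0 : 0 ≤ y := sq_nonneg _
    have y3 : b * y ≤ b^2 + y^2 := by nlinarith [sq_nonneg (b-y), mul_nonneg hb hy0]
    have y4 : (X-2) * y ≤ (X-2)^2 + y^2 := by nlinarith [sq_nonneg (X-2-y), mul_nonneg (by linarith : 0 ≤ X-2) hy0]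
    have y5 : 0 ≤ (X-2) * y := mul_nonneg (by linarith) hy0
    have y6 : 0 ≤ (X-2)^2 := sq_nonneg _
    nlinarith [sq_nonneg ρ]

lemma arctan_int (θ ρ s0 p q : ℝ) (hθ : 0 < θ) (hρ : 0 < ρ) :
    ∫ s in p..q, 1 / (θ^2 * (s - s0)^2 + ρ^2) ≤ Real.pi / (θ * ρ) := by
  have hd : ∀ s ∈ Set.uIcc p q, HasDerivAt (fun s => Real.arctan (θ/ρ * (s - s0)) / (θ*ρ)) (1 / (θ^2 * (s - s0)^2 + ρ^2)) s := by
    intro s _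
    have h1 : HasDerivAt (fun s => θ/ρ * (s - s0)) (θ/ρ * 1) s := ((hasDerivAt_id s).sub_const s0).const_mul _
    refine (h1.arctan.div_const (θ*ρ)).congr_deriv ?_
    have : 0 < θ^2 * (s - s0)^2 + ρ^2 := by positivity
    have : 0 < 1 + (θ/ρ * (s-s0))^2 := by positivity
    field_simp
    ring
  have hpos : ∀ s, θ^2 * (s - s0)^2 + ρ^2 ≠ 0 := fun s => by positivity
  rw [intervalIntegral.integral_eq_sub_of_hasDerivAt hd
    ((by fun_prop (disch := exact hpos _) : Continuous _).intervalIntegrable _ _), ← sub_div]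
  gcongr
  linarith [Real.arctan_lt_pi_div_two (θ/ρ * (q - s0)), Real.neg_pi_div_two_lt_arctan (θ/ρ * (p - s0))]

lemma int_half (X b ρ θ : ℝ) (hX : 0 ≤ X) (hb : 0 ≤ b) (hρ : b ≤ ρ) (hρ0 : 0 < ρ) (hθ0 : 0 < θ) (hθ : θ^2 = b + |2 - X|) :
    ∫ s in (0:ℝ)..Real.pi, 1 / ((X - 2 * Real.cos s)^2 + ρ^2) ≤ 2500 * Real.pi / (θ * ρ) := by
  obtain ⟨s0, hs⟩ := ptwise X b ρ θ hX hb hρ hθ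
  have hpos : ∀ s, θ^2 * (s - s0)^2 + ρ^2 ≠ 0 := fun s => by positivity
  have hpos2 : ∀ s, (X - 2 * Real.cos s)^2 + ρ^2 ≠ 0 := fun s => by positivity
  calc _ ≤ ∫ s in (0:ℝ)..Real.pi, 2500 * (1 / (θ^2 * (s - s0)^2 + ρ^2)) := by
        refine intervalIntegral.integral_mono_on Real.pi_pos.le
          ((by fun_prop (disch := exact hpos2 _) : Continuous _).intervalIntegrable _ _)
          ((by fun_prop (disch := exact hpos _) : Continuous _).intervalIntegrable _ _) ?_
        intro s h
        have := hs s h.1 h.2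
        have p1 : 0 < θ^2 * (s - s0)^2 + ρ^2 := by positivity
        have p2 : 0 < (X - 2 * Real.cos s)^2 + ρ^2 := by positivity
        rw [mul_one_div, div_le_div_iff₀ p2 p1]; linarith
    _ ≤ 2500 * (Real.pi / (θ * ρ)) := by
        rw [intervalIntegral.integral_const_mul]
        gcongr
        exact arctan_int θ ρ s0 _ _ hθ0 hρ0
    _ = _ := by ring

lemma int_full (X b ρ θ : ℝ) (hX : 0 ≤ X) (hb : 0 ≤ b) (hρ : b ≤ ρ) (hρ0 : 0 < ρ) (hθ0 : 0 < θ) (hθ : θ^2 = b + |2 - X|) :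
    ∫ s in (-Real.pi)..Real.pi, 1 / ((X - 2 * Real.cos s)^2 + ρ^2) ≤ 5000 * Real.pi / (θ * ρ) := by
  have hpos2 : ∀ s, (X - 2 * Real.cos s)^2 + ρ^2 ≠ 0 := fun s => by positivity
  have hi : ∀ p q, IntervalIntegrable (fun s => 1 / ((X - 2 * Real.cos s)^2 + ρ^2)) volume p q := fun p q =>
    (by fun_prop (disch := exact hpos2 _) : Continuous _).intervalIntegrable _ _
  have h := int_half X b ρ θ hX hb hρ hρ0 hθ0 hθ
  rw [← intervalIntegral.integral_add_adjacent_intervals (hi (-Real.pi) 0) (hi 0 Real.pi)]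
  have e : ∫ s in (-Real.pi)..0, 1 / ((X - 2 * Real.cos s)^2 + ρ^2) = ∫ s in (0:ℝ)..Real.pi, 1 / ((X - 2 * Real.cos s)^2 + ρ^2) := by
    have := intervalIntegral.integral_comp_neg (a := -Real.pi) (b := 0) (fun s => 1 / ((X - 2 * Real.cos s)^2 + ρ^2))
    simp only [Real.cos_neg, neg_zero, neg_neg] at this
    exact this
  rw [e]
  have : 5000 * Real.pi / (θ * ρ) = 2500 * Real.pi / (θ * ρ) + 2500 * Real.pi / (θ * ρ) := by ring
  linarith

lemma int1 (x b ρ θ : ℝ) (hb : 0 ≤ b) (hρ : b ≤ ρ) (hρ0 : 0 < ρ) (hθ0 : 0 < θ) (hθ : θ^2 = b + abs (2 - |x|)) :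
    ∫ s in (-Real.pi)..Real.pi, 1 / ((2 * Real.sin s + x)^2 + ρ^2) ≤ 5000 * Real.pi / (θ * ρ) := by
  have h := int_full |x| b ρ θ (abs_nonneg _) hb hρ hρ0 hθ0 hθ
  have hper : Function.Periodic (fun s => 1 / ((2 * Real.sin s + x)^2 + ρ^2)) (2 * Real.pi) := by
    intro s; simp [Real.sin_add_two_pi]
  refine le_trans (le_of_eq ?_) h
  rcases le_or_gt 0 x with hx | hx
  · have e1 := intervalIntegral.integral_comp_sub_right (a := -Real.pi) (b := Real.pi) (fun s => 1 / ((2 * Real.sin s + x)^2 + ρ^2)) (Real.pi/2)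
    have e2 := hper.intervalIntegral_add_eq (-Real.pi) (-Real.pi - Real.pi/2)
    rw [show -Real.pi + 2 * Real.pi = Real.pi by ring, show -Real.pi - Real.pi/2 + 2 * Real.pi = Real.pi - Real.pi/2 by ring, ← e1] at e2
    rw [e2]
    refine intervalIntegral.integral_congr fun s _ => ?_
    simp only [Real.sin_sub_pi_div_two, abs_of_nonneg hx]
    congr 2; ring
  · have e1 := intervalIntegral.integral_comp_add_right (a := -Real.pi) (b := Real.pi) (fun s => 1 / ((2 * Real.sin s + x)^2 + ρ^2)) (Real.pi/2)
    have e2 := hper.intervalIntegral_add_eq (-Real.pi) (-Real.pi + Real.pi/2)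
    rw [show -Real.pi + 2 * Real.pi = Real.pi by ring, show -Real.pi + Real.pi/2 + 2 * Real.pi = Real.pi + Real.pi/2 by ring, ← e1] at e2
    rw [e2]
    refine intervalIntegral.integral_congr fun s _ => ?_
    simp only [Real.sin_add_pi_div_two, abs_of_neg hx]
    congr 2; ring

lemma int2_aux (x ρ ε p q : ℝ) (hpq : p ≤ q) (hρ : 0 < ρ) (hε : |ε| = 1) (hs : ∀ s, p ≤ s → s ≤ q → |Real.cos s| = ε * Real.cos s) :
    ∫ s in p..q, |2 * Real.cos s| / ((2 * Real.sin s + x)^2 + ρ^2) ≤ Real.pi / ρ := by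
  have e : ∫ s in p..q, |2 * Real.cos s| / ((2 * Real.sin s + x)^2 + ρ^2) = ∫ s in p..q, ε * (2 * Real.cos s) / ((2 * Real.sin s + x)^2 + ρ^2) := by
    refine intervalIntegral.integral_congr fun s h => ?_
    rw [Set.uIcc_of_le hpq] at h
    simp only [abs_mul, hs s h.1 h.2, abs_two]; ring
  have hd : ∀ s ∈ Set.uIcc p q, HasDerivAt (fun s => ε * Real.arctan ((2 * Real.sin s + x)/ρ) / ρ) (ε * (2 * Real.cos s) / ((2 * Real.sin s + x)^2 + ρ^2)) s := by
    intro s _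
    have h1 : HasDerivAt (fun s => (2 * Real.sin s + x)/ρ) (2 * Real.cos s / ρ) s :=
      (((Real.hasDerivAt_sin s).const_mul 2).add_const x).div_const ρ
    refine ((h1.arctan.const_mul ε).div_const ρ).congr_deriv ?_
    have : 0 < (2 * Real.sin s + x)^2 + ρ^2 := by positivity
    have : 0 < 1 + ((2 * Real.sin s + x)/ρ)^2 := by positivity
    field_simp
    ring
  have hpos : ∀ s, (2 * Real.sin s + x)^2 + ρ^2 ≠ 0 := fun s => by positivity
  rw [e, intervalIntegral.integral_eq_sub_of_hasDerivAt hd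
    ((by fun_prop (disch := exact hpos _) : Continuous _).intervalIntegrable _ _), ← sub_div, ← mul_sub]
  gcongr
  refine (le_abs_self _).trans ?_
  rw [abs_mul, hε, one_mul, abs_le]
  constructor <;> linarith [Real.arctan_lt_pi_div_two ((2 * Real.sin q + x)/ρ), Real.neg_pi_div_two_lt_arctan ((2 * Real.sin p + x)/ρ),
    Real.arctan_lt_pi_div_two ((2 * Real.sin p + x)/ρ), Real.neg_pi_div_two_lt_arctan ((2 * Real.sin q + x)/ρ)]

lemma int2 (x ρ : ℝ) (hρ : 0 < ρ) :
    ∫ s in (-Real.pi)..Real.pi, |2 * Real.cos s| / ((2 * Real.sin s + x)^2 + ρ^2) ≤ 3 * Real.pi / ρ := by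
  have hp := Real.pi_pos
  have hpos : ∀ s, (2 * Real.sin s + x)^2 + ρ^2 ≠ 0 := fun s => by positivity
  have hi : ∀ p q, IntervalIntegrable (fun s => |2 * Real.cos s| / ((2 * Real.sin s + x)^2 + ρ^2)) volume p q := fun p q =>
    (by fun_prop (disch := exact hpos _) : Continuous _).intervalIntegrable _ _
  rw [← intervalIntegral.integral_add_adjacent_intervals (hi (-Real.pi) (-(Real.pi/2))) (hi _ Real.pi),
    ← intervalIntegral.integral_add_adjacent_intervals (hi (-(Real.pi/2)) (Real.pi/2)) (hi _ Real.pi)]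
  have a1 := int2_aux x ρ (-1) (-Real.pi) (-(Real.pi/2)) (by linarith) hρ (by simp) (by
    intro s h1 h2
    have : Real.cos s ≤ 0 := by
      rw [← Real.cos_neg]; exact Real.cos_nonpos_of_pi_div_two_le_of_le (by linarith) (by linarith)
    rw [abs_of_nonpos this]; ring)
  have a2 := int2_aux x ρ 1 (-(Real.pi/2)) (Real.pi/2) (by linarith) hρ (by simp) (by
    intro s h1 h2
    rw [abs_of_nonneg (Real.cos_nonneg_of_mem_Icc ⟨h1, h2⟩)]; ring)
  have a3 := int2_aux x ρ (-1) (Real.pi/2) Real.pi (by linarith) hρ (by simp) (by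
    intro s h1 h2
    rw [abs_of_nonpos (Real.cos_nonpos_of_pi_div_two_le_of_le (by linarith) (by linarith))]; ring)
  have : 3 * Real.pi / ρ = Real.pi / ρ + (Real.pi / ρ + Real.pi / ρ) := by ring
  linarith

end ALD

namespace ALD
open MeasureTheory
variable {f : ℤ → ℂ} {A K : ℝ}

lemma m_deriv (x ρ ξ : ℝ) (hρ : 0 < ρ) :
    HasDerivAt (fun ξ => (2 * Real.sin ξ + x) / ((2 * Real.sin ξ + x)^2 + ρ^2))
      ((2 * Real.cos ξ) * (ρ^2 - (2 * Real.sin ξ + x)^2) / ((2 * Real.sin ξ + x)^2 + ρ^2)^2) ξ := by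
  have h1 : HasDerivAt (fun ξ => 2 * Real.sin ξ + x) (2 * Real.cos ξ) ξ :=
    ((Real.hasDerivAt_sin ξ).const_mul 2).add_const x
  have h2 : HasDerivAt (fun ξ => (2 * Real.sin ξ + x)^2 + ρ^2) (2 * (2 * Real.sin ξ + x) * (2 * Real.cos ξ)) ξ := by
    refine ((h1.pow 2).add_const (ρ^2)).congr_deriv ?_
    simp
  have hp : (2 * Real.sin ξ + x)^2 + ρ^2 ≠ 0 := by positivity
  refine (h1.div h2 hp).congr_deriv ?_
  field_simp
  ring

lemma Dat.osc (H : Dat f A K) (t b ρ θ : ℝ) (n : ℤ) (ht : 0 < t) (hb : 0 ≤ b) (hρ : b ≤ ρ) (hρ0 : 0 < ρ) (hθ0 : 0 < θ)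
    (hθ : θ^2 = b + abs (2 - |(n:ℝ)/t|)) :
    ‖∫ ξ in (-Real.pi)..Real.pi, hh t n ξ * discFT f ξ‖ ≤
      A * ρ^2 * (5000 * Real.pi / (θ * ρ)) + (1/t) * (K * Real.sqrt (5000 * Real.pi / (θ * ρ)) + A * (3 * Real.pi / ρ)) := by
  have hF := H.cont
  have hhc := hh_cont t n
  have hdc := hd_cont t n
  have hpi := Real.pi_pos
  have hA := H.hA
  have hK := H.hK
  set x := (n:ℝ)/t with hx
  set D : ℝ → ℝ := fun ξ => 2 * Real.sin ξ + x with hD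
  have hDc : Continuous D := by simp only [hD]; fun_prop
  have hpos : ∀ ξ, 0 < D ξ ^2 + ρ^2 := fun ξ => by positivity
  have hne : ∀ ξ, D ξ ^2 + ρ^2 ≠ 0 := fun ξ => (hpos ξ).ne'
  have hne2 : ∀ ξ, (D ξ ^2 + ρ^2)^2 ≠ 0 := fun ξ => pow_ne_zero _ (hne ξ)
  set m : ℝ → ℝ := fun ξ => D ξ / (D ξ ^2 + ρ^2) with hm
  set m' : ℝ → ℝ := fun ξ => (2 * Real.cos ξ) * (ρ^2 - D ξ ^2) / (D ξ ^2 + ρ^2)^2 with hm'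
  have hmc : Continuous m := by simp only [hm]; fun_prop (disch := exact hne _)
  have hm'c : Continuous m' := by simp only [hm']; fun_prop (disch := exact hne2 _)
  have hmd : ∀ ξ, HasDerivAt m (m' ξ) ξ := fun ξ => m_deriv x ρ ξ hρ0
  set q : ℝ → ℝ := fun ξ => 1 / (D ξ ^2 + ρ^2) with hq
  have hqc : Continuous q := by simp only [hq]; fun_prop (disch := exact hne _)
  have hq0 : ∀ ξ, 0 ≤ q ξ := fun ξ => by simp only [hq]; have := hpos ξ; positivity
  have I1 : ∫ ξ in (-Real.pi)..Real.pi, q ξ ≤ 5000 * Real.pi / (θ * ρ) := int1 x b ρ θ hb hρ hρ0 hθ0 hθ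
  have I2 : ∫ ξ in (-Real.pi)..Real.pi, |2 * Real.cos ξ| * q ξ ≤ 3 * Real.pi / ρ := by
    have := int2 x ρ hρ0
    refine le_trans (le_of_eq ?_) this
    refine intervalIntegral.integral_congr fun ξ _ => ?_
    simp only [hq, hD]; rw [mul_one_div]
  have hle : -Real.pi ≤ Real.pi := by linarith
  have hmq : ∀ ξ, m ξ ^2 ≤ q ξ := by
    intro ξ
    simp only [hm, hq, div_pow]
    rw [div_le_div_iff₀ (by have := hpos ξ; positivity) (hpos ξ)]
    nlinarith [hpos ξ, sq_nonneg ρ]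
  have hm'q : ∀ ξ, |m' ξ| ≤ |2 * Real.cos ξ| * q ξ := by
    intro ξ
    simp only [hm', hq]
    rw [abs_div, abs_mul, mul_one_div, abs_of_pos (by have := hpos ξ; positivity : 0 < (D ξ ^2 + ρ^2)^2),
      div_le_div_iff₀ (by have := hpos ξ; positivity) (hpos ξ), mul_assoc]
    gcongr
    rw [sq (D ξ ^2 + ρ^2)]
    have := hpos ξ
    gcongr
    rw [abs_le]; constructor <;> nlinarith [sq_nonneg ρ, sq_nonneg (D ξ)]
  -- total derivative term
  have T := H.toolB (fun ξ => hh t n ξ * (m ξ : ℂ)) (fun ξ => hd t n ξ * (m ξ : ℂ) + hh t n ξ * (m' ξ : ℂ))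
    (fun ξ => (hh_deriv t n ξ).mul (hmd ξ).ofReal_comp) (by fun_prop) (by
      rw [hh_pi]; simp [hm, hD])
  have T1 : ∫ ξ in (-Real.pi)..Real.pi, ‖hh t n ξ * (m ξ : ℂ)‖^2 ≤ 5000 * Real.pi / (θ * ρ) := by
    refine le_trans ?_ I1
    refine intervalIntegral.integral_mono_on hle ((by fun_prop : Continuous _).intervalIntegrable _ _) (hqc.intervalIntegrable _ _) ?_
    intro ξ _
    rw [norm_mul, hh_norm, one_mul, Complex.norm_real, Real.norm_eq_abs, sq_abs]
    exact hmq ξ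
  have T2 : ‖∫ ξ in (-Real.pi)..Real.pi, hh t n ξ * (m' ξ : ℂ) * discFT f ξ‖ ≤ A * (3 * Real.pi / ρ) := by
    calc _ ≤ ∫ ξ in (-Real.pi)..Real.pi, A * (|2 * Real.cos ξ| * q ξ) := by
          refine intervalIntegral.norm_integral_le_of_norm_le hle (Filter.Eventually.of_forall fun ξ _ => ?_)
            ((by fun_prop : Continuous _).intervalIntegrable _ _)
          rw [norm_mul, norm_mul, hh_norm, one_mul, Complex.norm_real, Real.norm_eq_abs, mul_comm]
          exact mul_le_mul (H.bd ξ) (hm'q ξ) (abs_nonneg _) hA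
      _ ≤ _ := by
          rw [intervalIntegral.integral_const_mul]; gcongr
  have T3 : ‖∫ ξ in (-Real.pi)..Real.pi, hh t n ξ * ((ρ^2 * q ξ : ℝ) : ℂ) * discFT f ξ‖ ≤ A * ρ^2 * (5000 * Real.pi / (θ * ρ)) := by
    calc _ ≤ ∫ ξ in (-Real.pi)..Real.pi, A * ρ^2 * q ξ := by
          refine intervalIntegral.norm_integral_le_of_norm_le hle (Filter.Eventually.of_forall fun ξ _ => ?_)
            ((by fun_prop : Continuous _).intervalIntegrable _ _)
          have := hq0 ξ
          rw [norm_mul, norm_mul, hh_norm, one_mul, Complex.norm_real, Real.norm_of_nonneg (by positivity), mul_comm, mul_assoc]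
          gcongr
          exact H.bd ξ
      _ ≤ _ := by
          rw [intervalIntegral.integral_const_mul]; gcongr
  have split : ∫ ξ in (-Real.pi)..Real.pi, hh t n ξ * discFT f ξ =
      (∫ ξ in (-Real.pi)..Real.pi, hh t n ξ * ((ρ^2 * q ξ : ℝ) : ℂ) * discFT f ξ) +
      (Complex.I / t) * ((∫ ξ in (-Real.pi)..Real.pi, (hd t n ξ * (m ξ : ℂ) + hh t n ξ * (m' ξ : ℂ)) * discFT f ξ) -
        ∫ ξ in (-Real.pi)..Real.pi, hh t n ξ * (m' ξ : ℂ) * discFT f ξ) := by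
    rw [← intervalIntegral.integral_sub ((by fun_prop : Continuous _).intervalIntegrable _ _) ((by fun_prop : Continuous _).intervalIntegrable _ _),
      ← intervalIntegral.integral_const_mul,
      ← intervalIntegral.integral_add ((by fun_prop : Continuous _).intervalIntegrable _ _) ((by fun_prop : Continuous _).intervalIntegrable _ _)]
    refine intervalIntegral.integral_congr fun ξ _ => ?_
    have htc : (t:ℂ) ≠ 0 := by exact_mod_cast ht.ne'
    have r1 : (ρ^2 * q ξ) + D ξ * m ξ = 1 := by
      simp only [hq, hm]
      have := hne ξ
      field_simp
      ring
    have r1c : ((ρ^2 * q ξ : ℝ):ℂ) + (D ξ : ℂ) * (m ξ : ℂ) = 1 := by exact_mod_cast r1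
    have r2 : Complex.I / t * hd t n ξ = D ξ * hh t n ξ := by
      have : -(2 * t * Real.sin ξ + n) = - (t * D ξ) := by
        simp only [hD, hx]; field_simp
      rw [hd, this]
      push_cast
      field_simp
      linear_combination (-(D ξ : ℂ) * hh t n ξ) * Complex.I_sq
    linear_combination (-hh t n ξ * discFT f ξ) * r1c - (m ξ * discFT f ξ) * r2
  rw [split]
  refine (norm_add_le _ _).trans (add_le_add T3 ?_)
  rw [norm_mul, norm_div, Complex.norm_I, Complex.norm_real, Real.norm_of_nonneg ht.le]
  gcongr
  refine (norm_sub_le _ _).trans (add_le_add (T.trans ?_) T2)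
  gcongr

lemma Dat.pt {a : ℝ} (ha : 1 ≤ a) (H : Dat f A (A * a)) (n : ℤ) :
    ‖alProp f (a^6) n‖^2 * (a^6 * th a n) ≤ (16000 * A)^2 := by
  have hθ0 := th_pos ha n
  have hθg := th_ge ha n
  have hθs := th_sq ha n
  have hA := H.hA
  set θ := th a n with hθ
  set r := Real.sqrt θ with hr
  have hr0 : 0 < r := Real.sqrt_pos.2 hθ0
  have hr2 : r^2 = θ := Real.sq_sqrt hθ0.le
  have hra : a⁻¹ ≤ r := by
    apply Real.le_sqrt_of_sq_le; rw [inv_pow]; exact hθg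
  have ha0 : 0 < a := by linarith
  have hρb : (a^4)⁻¹ ≤ r / a^3 := by
    calc (a^4)⁻¹ = a⁻¹ / a^3 := by field_simp
      _ ≤ _ := by gcongr
  have hx : |(n:ℝ) / a^6| = |(n:ℝ)|/a^6 := by rw [abs_div, abs_of_pos (by positivity : 0 < a^6)]
  have h := H.osc (a^6) (a^4)⁻¹ (r/a^3) θ n (by positivity) (by positivity) hρb (by positivity) hθ0 (by rw [hx]; exact hθs)
  have hpi := Real.pi_pos
  have hpi2 := Real.pi_lt_d2
  have sq1 : Real.sqrt (5000 * Real.pi / (θ * (r/a^3))) ≤ 126 * a^2 / r := by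
    rw [Real.sqrt_le_iff]
    refine ⟨by positivity, ?_⟩
    have : (126 * a^2 / r)^2 = 126^2 * a^4 / θ := by rw [div_pow, hr2]; ring
    rw [this, ← div_div]
    calc 5000 * Real.pi / θ / (r/a^3) ≤ 5000 * Real.pi / θ / (a^4)⁻¹ := by gcongr
      _ = 5000 * Real.pi * a^4 / θ := by field_simp
      _ ≤ _ := by gcongr; linarith
  have b1 : ‖∫ ξ in (-Real.pi)..Real.pi, hh (a^6) n ξ * discFT f ξ‖ ≤ 16000 * A / (a^3 * r) := by
    refine h.trans ?_
    calc _ ≤ A * (r/a^3)^2 * (5000 * Real.pi / (θ * (r/a^3))) + 1/a^6 * (A * a * (126 * a^2 / r) + A * (3 * Real.pi / (r/a^3))) := by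
          gcongr
      _ = (5000 * Real.pi + 126 + 3 * Real.pi) * A / (a^3 * r) := by
          rw [← hr2]; field_simp; ring
      _ ≤ _ := by gcongr; linarith
  have c1 : cst ≤ 1 := by
    have := cst_sq
    have := cst_pos
    by_contra hc
    push Not at hc
    nlinarith [Real.pi_gt_three]
  have b2 : ‖alProp f (a^6) n‖ ≤ 16000 * A / (a^3 * r) := by
    rw [alProp_eq, norm_mul, Complex.norm_real, Real.norm_of_nonneg cst_pos.le]
    exact (mul_le_of_le_one_left (norm_nonneg _) c1).trans b1
  calc _ ≤ (16000 * A / (a^3 * r))^2 * (a^6 * θ) := by gcongr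
    _ = _ := by rw [← hr2]; field_simp

lemma Dat.hyp {a : ℝ} (ha : 1 ≤ a) (hA : 0 < A) (H : Dat f A (A * a)) :
    Hyp a 16000 (fun n => Complex.I ^ (-n) * alProp f (a^6) n / A) (fun n => Complex.I ^ (-n) * gt f (a^6) n / A) := by
  have hAc : (A:ℂ) ≠ 0 := by exact_mod_cast hA.ne'
  have nI : ∀ n : ℤ, ‖Complex.I ^ n‖ = 1 := fun n => by rw [norm_zpow, Complex.norm_I, one_zpow]
  have nn : ∀ (z : ℂ) (n : ℤ), ‖Complex.I ^ (-n) * z / A‖^2 = ‖z‖^2 / A^2 := by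
    intro z n
    rw [norm_div, norm_mul, nI, one_mul, Complex.norm_real, Real.norm_of_nonneg hA.le, div_pow]
  refine ⟨ha, by norm_num, ?_, ?_, ?_, ?_⟩
  · intro n
    have h := H.recu (a^6) n
    have e1 : Complex.I ^ (-(n-1)) = Complex.I ^ (-n) * Complex.I := by
      rw [show -(n-1) = -n + 1 by ring, zpow_add₀ Complex.I_ne_zero, zpow_one]
    have e2 : Complex.I ^ (-(n+1)) = Complex.I ^ (-n) * (-Complex.I) := by
      rw [show -(n+1) = -n + -1 by ring, zpow_add₀ Complex.I_ne_zero, zpow_neg_one, Complex.inv_I]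
    simp only [e1, e2]
    push_cast at h
    field_simp
    linear_combination h
  · intro s
    simp only [nn]
    rw [← Finset.sum_div, div_le_iff₀ (by positivity)]
    refine (H.u2 (a^6) s).trans ?_
    gcongr
    linarith [Real.pi_lt_four]
  · intro s
    simp only [nn]
    rw [← Finset.sum_div, div_le_iff₀ (by positivity)]
    refine (H.g2 (a^6) s).trans ?_
    nlinarith [mul_nonneg (sq_nonneg A) (sq_nonneg a)]
  · intro n
    simp only [nn]
    rw [div_mul_eq_mul_div, div_le_iff₀ (by positivity), ← mul_pow]
    exact H.pt ha n

lemma E_at_pi (k : ℤ) : E k Real.pi = ((sg k : ℝ) : ℂ) := by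
  rw [E, sg, show Complex.I * (k:ℂ) * (Real.pi:ℂ) = (k:ℂ) * ((Real.pi:ℂ) * Complex.I) by ring, Complex.exp_int_mul, Complex.exp_pi_mul_I]
  push_cast; rfl

lemma sg_neg (k : ℤ) : sg (-k) = sg k := by
  simp only [sg, zpow_neg, ← inv_zpow]; norm_num

lemma Kint (k : ℤ) : ∫ ξ in (-Real.pi)..Real.pi, ((Real.sin (ξ/2) : ℝ):ℂ) * E (-k) ξ =
    2 * Complex.I * ((sg k * ((k:ℝ) / ((k:ℝ)^2 - 1/4)) : ℝ) : ℂ) := by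
  have h0r : (k:ℝ)^2 - 1/4 ≠ 0 := by
    intro h
    have h4 : 4 * (k:ℝ)^2 = 1 := by linarith
    have h5 : 4 * k^2 = 1 := by exact_mod_cast h4
    omega
  have h0 : (k:ℂ)^2 - 1/4 ≠ 0 := by
    intro h
    exact h0r (Complex.ofReal_eq_zero.1 (by push_cast; exact h))
  set d : ℂ := ((k:ℂ)^2 - 1/4)⁻¹ with hd
  have hdd : ((k:ℂ)^2 - 1/4) * d = 1 := mul_inv_cancel₀ h0
  clear_value d
  have hderiv : ∀ ξ ∈ Set.uIcc (-Real.pi) Real.pi, HasDerivAt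
      (fun ξ : ℝ => E (-k) ξ * (d/2 * ((Real.cos (ξ/2) : ℝ):ℂ) + Complex.I * k * d * ((Real.sin (ξ/2) : ℝ):ℂ)))
      (((Real.sin (ξ/2) : ℝ):ℂ) * E (-k) ξ) ξ := by
    intro ξ _
    have e0 : HasDerivAt (fun ξ : ℝ => ξ/2) (1/2) ξ := (hasDerivAt_id ξ).div_const 2
    have e1 := (e0.cos).ofReal_comp.const_mul (d/2)
    have e2 := (e0.sin).ofReal_comp.const_mul (Complex.I * k * d)
    refine ((E_deriv (-k) ξ).mul (e1.add e2)).congr_deriv ?_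
    simp only [Pi.add_apply]
    push_cast
    linear_combination (Complex.sin (ξ/2) * E (-k) ξ) * hdd - (E (-k) ξ * k^2 * d * Complex.sin (ξ/2)) * Complex.I_sq
  rw [intervalIntegral.integral_eq_sub_of_hasDerivAt hderiv
    ((by have := E_cont (-k); fun_prop : Continuous _).intervalIntegrable _ _)]
  rw [← E_pi, E_at_pi, sg_neg, neg_div, Real.cos_neg, Real.sin_neg, Real.cos_pi_div_two, Real.sin_pi_div_two]
  push_cast
  rw [div_eq_mul_inv (k:ℂ), ← hd]
  ring

lemma Dat.main {a : ℝ} (ha : 1 ≤ a) (hA : 0 < A) (H : Dat f A (A * a)) (n : ℤ) :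
    ‖(Real.sqrt (2 * Real.pi) : ℂ)⁻¹ *
            ∫ ξ in (-Real.pi)..Real.pi,
              ((Real.sin (ξ / 2) : ℝ) : ℂ) *
                ((Real.sqrt (2 * Real.pi) : ℂ)⁻¹ *
                  ∑' m : ℤ, ((‖alProp f (a^6) m‖ ^ 2 : ℝ) : ℂ) *
                    Complex.exp (Complex.I * (m : ℂ) * (ξ : ℂ))) *
                Complex.exp (-(Complex.I * (n : ℂ) * (ξ : ℂ)))‖ ≤
          (4000100 * 16000^2) * A ^ 2 * (a^6)⁻¹ := by
  have hfin := (H.hyp ha hA).final n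
  have hc : ((Real.sqrt (2 * Real.pi) : ℂ))⁻¹ = (cst : ℂ) := by rw [cst]; push_cast; rfl
  have hsum : Summable (fun m => ‖((‖alProp f (a^6) m‖ ^ 2 : ℝ) : ℂ)‖) := by
    have : Summable (fun m => ‖alProp f (a^6) m‖ ^ 2) := summable_of_sum_le (fun _ => by positivity) (H.u2 (a^6))
    refine this.congr fun m => ?_
    rw [Complex.norm_real, Real.norm_of_nonneg (by positivity)]
  have hE := E_cont (-n)
  have hsw := swap (fun ξ => ((Real.sin (ξ / 2) : ℝ) : ℂ) * E (-n) ξ) (by fun_prop) _ hsum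
  have e1 : ∫ ξ in (-Real.pi)..Real.pi,
              ((Real.sin (ξ / 2) : ℝ) : ℂ) *
                ((Real.sqrt (2 * Real.pi) : ℂ)⁻¹ *
                  ∑' m : ℤ, ((‖alProp f (a^6) m‖ ^ 2 : ℝ) : ℂ) *
                    Complex.exp (Complex.I * (m : ℂ) * (ξ : ℂ))) *
                Complex.exp (-(Complex.I * (n : ℂ) * (ξ : ℂ))) =
      cst * ∫ ξ in (-Real.pi)..Real.pi, (((Real.sin (ξ / 2) : ℝ) : ℂ) * E (-n) ξ) * ∑' m : ℤ, ((‖alProp f (a^6) m‖ ^ 2 : ℝ) : ℂ) * E m ξ := by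
    rw [← intervalIntegral.integral_const_mul]
    refine intervalIntegral.integral_congr fun ξ _ => ?_
    simp only [hc, E]
    rw [show -(Complex.I * (n:ℂ) * ξ) = Complex.I * ((-n:ℤ):ℂ) * ξ by push_cast; ring]
    ring
  have e2 : ∀ m : ℤ, ((‖alProp f (a^6) m‖ ^ 2 : ℝ) : ℂ) * ∫ ξ in (-Real.pi)..Real.pi, (((Real.sin (ξ / 2) : ℝ) : ℂ) * E (-n) ξ) * E m ξ
      = 2 * Complex.I * A^2 * ((‖Complex.I ^ (-m) * alProp f (a^6) m / A‖^2 * (sg (n-m) * (((n:ℝ)-m) / (((n:ℝ)-m)^2 - 1/4))) : ℝ) : ℂ) := by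
    intro m
    have : ∫ ξ in (-Real.pi)..Real.pi, (((Real.sin (ξ / 2) : ℝ) : ℂ) * E (-n) ξ) * E m ξ =
        ∫ ξ in (-Real.pi)..Real.pi, ((Real.sin (ξ / 2) : ℝ) : ℂ) * E (-(n-m)) ξ := by
      refine intervalIntegral.integral_congr fun ξ _ => ?_
      rw [show -(n-m) = -n + m by ring, E_add]; ring
    rw [this, Kint]
    have hn : ‖Complex.I ^ (-m) * alProp f (a^6) m / A‖^2 = ‖alProp f (a^6) m‖^2 / A^2 := by
      rw [norm_div, norm_mul, norm_zpow, Complex.norm_I, one_zpow, one_mul, Complex.norm_real, Real.norm_of_nonneg hA.le, div_pow]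
    rw [hn]
    have hAc : (A:ℂ) ≠ 0 := by exact_mod_cast hA.ne'
    push_cast
    field_simp
  have e3 := hsw.tsum_eq
  simp_rw [e2] at e3
  rw [tsum_mul_left, ← Complex.ofReal_tsum] at e3
  rw [e1, hc, ← e3]
  simp only [norm_mul, Complex.norm_real, Complex.norm_I, norm_pow, Real.norm_eq_abs, abs_of_pos cst_pos, abs_of_pos hA, Complex.norm_ofNat]
  have hcs := cst_sq
  have h2 : cst^2 * 2 ≤ 1 := by nlinarith [Real.pi_gt_three, sq_nonneg cst]
  set S := |∑' m : ℤ, ‖Complex.I ^ (-m) * alProp f (a^6) m / A‖^2 * (sg (n-m) * (((n:ℝ)-m) / (((n:ℝ)-m)^2 - 1/4)))| with hS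
  have hS0 : 0 ≤ S := abs_nonneg _
  calc _ = cst^2 * 2 * (A^2 * S) := by ring
    _ ≤ 1 * (A^2 * S) := by gcongr
    _ ≤ 1 * (A^2 * (4000100 * 16000^2 / a^6)) := by gcongr
    _ = _ := by ring

end ALD

/-- Bilinear decay for the multiplier `sin(D/2)` applied to `|u(t)|²`:
`|sin(D/2)|u(t)|²|_n ≤ C A² t^{−1}`, where `q` is the Fourier transform of the
sequence `m ↦ |u_m(t)|²`. -/
theorem alProp_sin_half_multiplier_decay :
    ∃ C : ℝ, 0 < C ∧ ∀ (t A : ℝ), 1 ≤ t → 0 < A → ∀ f : ℤ → ℂ,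
      (∀ ξ : ℝ, ‖discFT f ξ‖ ≤ A) →
      Summable (fun n : ℤ => (n : ℝ) ^ 2 * ‖f n‖ ^ 2) →
      Real.sqrt (∑' n : ℤ, (n : ℝ) ^ 2 * ‖f n‖ ^ 2) ≤ A * t ^ ((1 : ℝ) / 6) →
      ∀ n : ℤ,
        ‖(Real.sqrt (2 * Real.pi) : ℂ)⁻¹ *
            ∫ ξ in (-Real.pi)..Real.pi,
              ((Real.sin (ξ / 2) : ℝ) : ℂ) *
                ((Real.sqrt (2 * Real.pi) : ℂ)⁻¹ *
                  ∑' m : ℤ, ((‖alProp f t m‖ ^ 2 : ℝ) : ℂ) *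
                    Complex.exp (Complex.I * (m : ℂ) * (ξ : ℂ))) *
                Complex.exp (-(Complex.I * (n : ℂ) * (ξ : ℂ)))‖ ≤
          C * A ^ 2 * t⁻¹ := by
  refine ⟨4000100 * 16000^2, by norm_num, ?_⟩
  intro t A ht hA f hbd hsm hle n
  have ht0 : 0 ≤ t := by linarith
  have ha6 : (t ^ ((1:ℝ)/6))^6 = t := by
    rw [← Real.rpow_natCast, ← Real.rpow_mul ht0]; norm_num
  have ha : 1 ≤ t ^ ((1:ℝ)/6) := Real.one_le_rpow ht (by norm_num)
  have H : ALD.Dat f A (A * t ^ ((1:ℝ)/6)) := by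
    refine ⟨hA.le, by positivity, hbd, hsm, ?_⟩
    exact (Real.sqrt_le_left (by positivity)).1 hle
  have := H.main ha hA n
  rw [ha6] at this
  exact this
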